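/- arXiv:2510.06392 — 2 statements merged into one kernel-verified Lean document; each statement's English description precedes it below -/
import Mathlib

section
/- Every super-minimally 2-connected graph G is a cycle; in particular, G has exactly |V(G)| edges and every vertex of G has degree two. -/
open SimpleGraph

/-- A graph is `k`-connected if it has more than `k` vertices and the deletion of any set of
fewer than `k` vertices leaves a connected graph (equivalently, there is no vertex cut of size
less than `k`). -/
def KConnected {V : Type*} (k : ℕ) (G : SimpleGraph V) : Prop :=
  k < Nat.card V ∧ ∀ S : Set V, S.ncard < k → (G.induce Sᶜ).Connected

/-- A graph is super-minimally `k`-connected if it is `k`-connected but no proper subgraph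
is `k`-connected. -/
def SuperMinimallyKConnected {V : Type*} (k : ℕ) (G : SimpleGraph V) : Prop :=
  KConnected k G ∧ ∀ H : G.Subgraph, H ≠ ⊤ → ¬ KConnected k H.coe

theorem KConnected.of_iso {V W : Type*} {k : ℕ} {G : SimpleGraph V} {H : SimpleGraph W}
    (e : G ≃g H) (hG : KConnected k G) : KConnected k H := by
  refine ⟨Nat.card_congr e.toEquiv ▸ hG.1, fun S hS => ?_⟩
  have hcard : (e ⁻¹' S).ncard < k := by
    rwa [Set.ncard_preimage_of_injective_subset_range e.injective
      (e.surjective.range_eq ▸ Set.subset_univ S)]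
  refine (hG.2 _ hcard).map ⟨fun x => ⟨e x.1, x.2⟩, fun h => e.map_adj_iff.2 h⟩ ?_
  rintro ⟨w, hw⟩
  exact ⟨⟨e.symm w, by simpa using hw⟩, Subtype.ext (e.apply_symm_apply w)⟩

open Fin.CommRing in
theorem cycleGraph_induce_compl_singleton_connected (m : ℕ) (v : Fin (m + 3)) :
    ((cycleGraph (m + 3)).induce {v}ᶜ).Connected := by
  have hne : ∀ i : ℕ, i < m + 2 → v + ((i + 1 : ℕ) : Fin (m + 3)) ∈ ({v}ᶜ : Set _) := by
    intro i hi h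
    have h0 : ((i + 1 : ℕ) : Fin (m + 3)) = 0 := add_eq_left.1 (Set.mem_singleton_iff.1 h)
    exact Nat.not_dvd_of_pos_of_lt i.succ_pos (by lia) (Fin.natCast_eq_zero.1 h0)
  have hreach : ∀ i (hi : i < m + 2),
      ((cycleGraph (m + 3)).induce {v}ᶜ).Reachable ⟨_, hne 0 (by lia)⟩ ⟨_, hne i hi⟩ := by
    intro i
    induction i with
    | zero => exact fun _ => .rfl
    | succ i ih =>
      refine fun hi => (ih (by lia)).trans (Adj.reachable ?_)
      rw [comap_adj]
      refine cycleGraph_adj.2 (Or.inr ?_)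
      simp only [Function.Embedding.subtype_apply]
      push_cast
      abel
  rw [connected_iff_exists_forall_reachable]
  refine ⟨⟨_, hne 0 (by lia)⟩, fun ⟨u, hu⟩ => ?_⟩
  have hpos : (u - v).val ≠ 0 := by
    rw [Ne, Fin.val_eq_zero_iff, sub_eq_zero]
    exact hu
  have hlt := (u - v).isLt
  have hu' : v + (((u - v).val - 1 + 1 : ℕ) : Fin (m + 3)) = u := by
    rw [Nat.sub_add_cancel (by lia), Fin.cast_val_eq_self]
    abel
  convert hreach ((u - v).val - 1) (by lia) using 2
  exact hu'.symm

theorem kConnected_two_cycleGraph {n : ℕ} (hn : 3 ≤ n) : KConnected 2 (cycleGraph n) := by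
  obtain ⟨m, rfl⟩ := Nat.exists_eq_add_of_le' hn
  refine ⟨by simp, fun S hS => ?_⟩
  obtain rfl | ⟨v, rfl⟩ := (Set.ncard_le_one_iff_eq S.toFinite).1 (Nat.le_of_lt_succ hS)
  · rw [Set.compl_empty]
    exact (induceUnivIso _).connected_iff.2 cycleGraph_connected
  · exact cycleGraph_induce_compl_singleton_connected m v

theorem KConnected.not_isAcyclic {V : Type*} [Finite V] {G : SimpleGraph V}
    (hG : KConnected 2 G) : ¬ G.IsAcyclic := by
  classical
  have := Fintype.ofFinite V
  intro hacyc
  have hconn : G.Connected := by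
    have := hG.2 ∅ (by simp)
    rw [Set.compl_empty] at this
    exact (induceUnivIso G).connected_iff.1 this
  have : Nontrivial V := Finite.one_lt_card_iff_nontrivial.1 (by have := hG.1; lia)
  obtain ⟨v, hv⟩ := IsTree.exists_vert_degree_one_of_nontrivial ⟨hconn, hacyc⟩
  obtain ⟨u, huv, hu⟩ := degree_eq_one_iff_existsUnique_adj.1 hv
  obtain ⟨w, hw⟩ : ∃ w, w ∉ ({u, v} : Set V) := by
    by_contra! h
    have huniv : Set.univ ⊆ ({u, v} : Set V) := fun x _ => h x
    have hle := Set.ncard_le_ncard huniv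
    rw [Set.ncard_univ, Set.ncard_pair huv.ne'] at hle
    exact hle.not_gt hG.1
  have hw' : w ≠ u ∧ w ≠ v := by simpa using hw
  have hc := hG.2 {u} (by simp)
  have : Nontrivial ({u}ᶜ : Set V) :=
    ⟨⟨v, huv.ne⟩, ⟨w, hw'.1⟩, fun h => hw'.2 (Subtype.ext_iff.1 h).symm⟩
  obtain ⟨⟨x, hx⟩, hvx⟩ := hc.preconnected.exists_adj_of_nontrivial ⟨v, huv.ne⟩
  exact hx (hu x hvx)

theorem SuperMinimallyKConnected.exists_iso_cycleGraph {V : Type*} [Finite V]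
    {G : SimpleGraph V} (h : SuperMinimallyKConnected 2 G) :
    ∃ n, 3 ≤ n ∧ Nonempty (G ≃g cycleGraph n) := by
  have hcyc := h.1.not_isAcyclic
  rw [isAcyclic_iff_free_cycleGraph] at hcyc
  push Not at hcyc
  obtain ⟨n, hn, ⟨f⟩⟩ := hcyc
  have htop : f.toSubgraph = ⊤ := by
    by_contra hne
    exact h.2 _ hne ((kConnected_two_cycleGraph hn).of_iso f.isoToSubgraph)
  have e := f.isoToSubgraph
  rw [htop] at e
  exact ⟨n, hn, ⟨(e.trans Subgraph.topIso).symm⟩⟩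

theorem ncard_neighborSet_cycleGraph {n : ℕ} (hn : 3 ≤ n) (v : Fin n) :
    ((cycleGraph n).neighborSet v).ncard = 2 := by
  obtain ⟨m, rfl⟩ := Nat.exists_eq_add_of_le' hn
  rw [Set.ncard_eq_toFinset_card', ← neighborFinset_def, card_neighborFinset_eq_degree,
    cycleGraph_degree_three_le]

theorem ncard_edgeSet_eq_card_of_ncard_neighborSet_eq_two {V : Type*} [Fintype V]
    {G : SimpleGraph V} (h : ∀ v, (G.neighborSet v).ncard = 2) :
    G.edgeSet.ncard = Nat.card V := by
  classical
  have hdeg : ∀ v, G.degree v = 2 := fun v => by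
    rw [← card_neighborFinset_eq_degree, neighborFinset_def, ← Set.ncard_eq_toFinset_card', h]
  have hsum := G.sum_degrees_eq_twice_card_edges
  simp only [hdeg, Finset.sum_const, Finset.card_univ, smul_eq_mul] at hsum
  rw [Set.ncard_eq_toFinset_card', ← edgeFinset, Nat.card_eq_fintype_card]
  lia

/-- Every super-minimally 2-connected graph is a cycle; in particular it has
exactly `|V(G)|` edges and every vertex has degree two. -/
theorem superMinimally_two_connected_is_cycle {V : Type*} [Fintype V] (G : SimpleGraph V)
    (h : SuperMinimallyKConnected 2 G) :
    (∃ n, 3 ≤ n ∧ Nonempty (G ≃g cycleGraph n)) ∧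
      G.edgeSet.ncard = Nat.card V ∧ ∀ v : V, (G.neighborSet v).ncard = 2 := by
  have hcycle := h.exists_iso_cycleGraph
  obtain ⟨n, hn, ⟨e⟩⟩ := hcycle
  have hdeg : ∀ v : V, (G.neighborSet v).ncard = 2 := fun v =>
    (Set.ncard_congr' (e.mapNeighborSet v)).trans (ncard_neighborSet_cycleGraph hn _)
  exact ⟨⟨n, hn, ⟨e⟩⟩, ncard_edgeSet_eq_card_of_ncard_neighborSet_eq_two hdeg, hdeg⟩
end

section
/- If G is a super-minimally 3-connected graph, then the number of vertices of G having degree exactly three is at least (|V(G)| + 3)/2; equivalently, 2·|{v ∈ V(G) : deg(v) = 3}| ≥ |V(G)| + 3. -/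
open SimpleGraph

/-- Every nonempty set whose outer boundary is contained in a set of two vertices covers the
whole graph together with these two vertices. -/
def NoSmallCut {V : Type*} (G : SimpleGraph V) : Prop :=
  ∀ (X : Set V) (p q : V), X.Nonempty →
    (∀ x ∈ X, ∀ y, G.Adj x y → y ∈ X ∨ y = p ∨ y = q) → ∀ y, y ∈ X ∨ y = p ∨ y = q

theorem ncard_pair_le {V : Type*} (a b : V) : ({a, b} : Set V).ncard ≤ 2 :=
  (Set.ncard_insert_le a {b}).trans (by simp)

theorem KConnected.noSmallCut {V : Type*} [Finite V] {G : SimpleGraph V} (h : KConnected 3 G) :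
    NoSmallCut G := by
  intro X p q hX hcl y
  by_contra! hy
  obtain ⟨x, hx⟩ := hX
  have hcard : (({p, q} : Set V) \ X).ncard < 3 :=
    ((Set.ncard_le_ncard Set.sdiff_subset).trans (ncard_pair_le p q)).trans_lt (by norm_num)
  have hxS : x ∈ ((({p, q} : Set V) \ X)ᶜ : Set V) := fun hc => hc.2 hx
  have hyS : y ∈ ((({p, q} : Set V) \ X)ᶜ : Set V) := fun hc => by
    rcases hc.1 with h1 | h1
    · exact hy.2.1 h1
    · exact hy.2.2 h1
  have hr := (h.2 _ hcard).preconnected ⟨x, hxS⟩ ⟨y, hyS⟩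
  rw [reachable_iff_reflTransGen] at hr
  have key : ∀ b, Relation.ReflTransGen (G.induce (({p, q} : Set V) \ X)ᶜ).Adj ⟨x, hxS⟩ b →
      (b : V) ∈ X := by
    intro b hb
    induction hb with
    | refl => exact hx
    | tail _ hadj ih =>
      rename_i b c _
      rcases hcl b ih c hadj with h1 | h1 | h1
      · exact h1
      · by_contra hc
        exact c.2 ⟨Or.inl h1, hc⟩
      · by_contra hc
        exact c.2 ⟨Or.inr h1, hc⟩
  exact hy.1 (key _ hr)

theorem exists_pair_of_ncard_lt_three {V : Type*} [Finite V] {S : Set V} (h : S.ncard < 3)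
    (a : V) : ∃ p q, (p ∈ S ∨ p = a) ∧ (q ∈ S ∨ q = a) ∧ ∀ s ∈ S, s = p ∨ s = q := by
  have h3 : S.ncard = 0 ∨ S.ncard = 1 ∨ S.ncard = 2 := by omega
  rcases h3 with h0 | h1 | h2
  · rw [Set.ncard_eq_zero] at h0
    exact ⟨a, a, Or.inr rfl, Or.inr rfl, by simp [h0]⟩
  · obtain ⟨p, rfl⟩ := Set.ncard_eq_one.mp h1
    exact ⟨p, p, by simp⟩
  · obtain ⟨p, q, -, rfl⟩ := Set.ncard_eq_two.mp h2
    exact ⟨p, q, by simp⟩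

theorem NoSmallCut.induce_compl_connected {V : Type*} [Finite V] {G : SimpleGraph V}
    (hG : NoSmallCut G) {S : Set V} (hS : S.ncard < 3) (hne : (Sᶜ : Set V).Nonempty) :
    (G.induce Sᶜ).Connected := by
  have : Nonempty (Sᶜ : Set V) := hne.to_subtype
  refine ⟨fun a b => ?_⟩
  obtain ⟨p, q, hp, hq, hSpq⟩ := exists_pair_of_ncard_lt_three hS (a : V)
  have ha : (a : V) ∈ {v | ∃ h : v ∈ Sᶜ, (G.induce Sᶜ).Reachable a ⟨v, h⟩} :=
    ⟨a.2, Reachable.refl _⟩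
  have key := hG {v | ∃ h : v ∈ Sᶜ, (G.induce Sᶜ).Reachable a ⟨v, h⟩} p q ⟨a, ha⟩ ?_ b
  · rcases key with ⟨_, h⟩ | h | h
    · exact h
    · rcases hp with hp | hp
      · exact absurd (h ▸ hp) b.2
      · rw [show b = a from Subtype.ext (h.trans hp)]
    · rcases hq with hq | hq
      · exact absurd (h ▸ hq) b.2
      · rw [show b = a from Subtype.ext (h.trans hq)]
  · rintro x ⟨hx, hr⟩ y hxy
    by_cases hy : y ∈ S
    · exact Or.inr (hSpq y hy)
    · exact Or.inl ⟨hy, hr.trans (Adj.reachable (G := G.induce Sᶜ) (u := ⟨x, hx⟩)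
        (v := ⟨y, hy⟩) hxy)⟩

theorem NoSmallCut.kConnected {V : Type*} [Finite V] {G : SimpleGraph V} (hG : NoSmallCut G)
    (hcard : 3 < Nat.card V) : KConnected 3 G := by
  refine ⟨hcard, fun S hS => hG.induce_compl_connected hS ?_⟩
  by_contra hne
  rw [Set.not_nonempty_iff_eq_empty, Set.compl_empty_iff] at hne
  rw [hne, Set.ncard_univ] at hS
  omega

theorem NoSmallCut.exists_adj_ne {V : Type*} [Finite V] {G : SimpleGraph V} (hG : NoSmallCut G)
    (hcard : 3 < Nat.card V) (x a b : V) : ∃ z, G.Adj x z ∧ z ≠ a ∧ z ≠ b := by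
  by_contra! hcon
  have h1 := hG {x} a b ⟨x, rfl⟩ (by
    rintro _ rfl y hy
    by_cases hya : y = a
    · exact Or.inr (Or.inl hya)
    · exact Or.inr (Or.inr (hcon y hy hya)))
  have h2 : (Set.univ : Set V) ⊆ {x, a, b} := fun y _ => h1 y
  have h3 := Set.ncard_le_ncard h2
  have h4 := Set.ncard_insert_le x ({a, b} : Set V)
  have h5 := ncard_pair_le a b
  rw [Set.ncard_univ] at h3
  omega

theorem NoSmallCut.three_le_ncard_neighborSet {V : Type*} [Finite V] {G : SimpleGraph V}
    (hG : NoSmallCut G) (hcard : 3 < Nat.card V) (x : V) : 3 ≤ (G.neighborSet x).ncard := by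
  by_contra! hlt
  obtain ⟨p, q, -, -, hpq⟩ := exists_pair_of_ncard_lt_three hlt x
  obtain ⟨z, hz, hp, hq⟩ := hG.exists_adj_ne hcard x p q
  rcases hpq z hz with h | h
  · exact hp h
  · exact hq h

theorem exists_adj_of_four_le_ncard {V : Type*} [Finite V] {G : SimpleGraph V} {x : V}
    (hx : 4 ≤ (G.neighborSet x).ncard) (a b c : V) :
    ∃ z, G.Adj x z ∧ z ≠ a ∧ z ≠ b ∧ z ≠ c := by
  by_contra! hcon
  have h2 : G.neighborSet x ⊆ {a, b, c} := fun y hy => by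
    by_cases h1 : y = a
    · exact Or.inl h1
    · by_cases h2 : y = b
      · exact Or.inr (Or.inl h2)
      · exact Or.inr (Or.inr (hcon y hy h1 h2))
  have h3 := Set.ncard_le_ncard h2
  have h4 := Set.ncard_insert_le a ({b, c} : Set V)
  have h5 := ncard_pair_le b c
  omega

/-- The edge `uv` is a bridge of `G - {p, q}` for some `p, q`, both sides of which have at least
two vertices. -/
def SplitEdge {V : Type*} (G : SimpleGraph V) (u v : V) : Prop :=
  G.Adj u v ∧ ∃ (X Y : Set V) (p q : V), u ∈ X ∧ v ∈ Y ∧ (∀ x ∈ X, x ∉ Y) ∧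
    p ∉ X ∧ p ∉ Y ∧ q ∉ X ∧ q ∉ Y ∧ (∀ z, z ∈ X ∨ z ∈ Y ∨ z = p ∨ z = q) ∧
    (∀ x ∈ X, ∀ y ∈ Y, G.Adj x y → x = u ∧ y = v) ∧ (∃ x ∈ X, x ≠ u) ∧ ∃ y ∈ Y, y ≠ v

theorem SplitEdge.symm {V : Type*} {G : SimpleGraph V} {u v : V} (h : SplitEdge G u v) :
    SplitEdge G v u := by
  obtain ⟨hadj, X, Y, p, q, hu, hv, hXY, hpX, hpY, hqX, hqY, hcov, he, hX, hY⟩ := h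
  refine ⟨hadj.symm, Y, X, p, q, hv, hu, fun x hx hx' => hXY x hx' hx, hpY, hpX, hqY, hqX,
    fun z => ?_, fun x hx y hy hxy => (he y hy x hx hxy.symm).symm, hY, hX⟩
  rcases hcov z with h | h | h
  · exact Or.inr (Or.inl h)
  · exact Or.inl h
  · exact Or.inr (Or.inr h)

theorem exists_third {V : Type*} {r : V → Prop} (h : ∃ a b c, a ≠ b ∧ a ≠ c ∧ b ≠ c ∧
    ∀ z, r z ↔ z = a ∨ z = b ∨ z = c) {u v : V} (hu : r u) (hv : r v) (huv : u ≠ v) :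
    ∃ w, w ≠ u ∧ w ≠ v ∧ ∀ z, r z ↔ z = u ∨ z = v ∨ z = w := by
  obtain ⟨a, b, c, hab, hac, hbc, hr⟩ := h
  have h1 := (hr u).mp hu
  have h2 := (hr v).mp hv
  have h3 : ∃ w, w ≠ u ∧ w ≠ v ∧ ∀ y, (y = a ∨ y = b ∨ y = c) ↔ (y = u ∨ y = v ∨ y = w) := by
    by_cases hc : c = u ∨ c = v
    · by_cases hb : b = u ∨ b = v
      · exact ⟨a, by grind⟩
      · exact ⟨b, by grind⟩
    · exact ⟨c, by grind⟩
  obtain ⟨w, hwu, hwv, hw⟩ := h3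
  exact ⟨w, hwu, hwv, fun y => (hr y).trans (hw y)⟩

theorem ncard_neighborSet_eq_three_iff {V : Type*} {G : SimpleGraph V} {t : V} :
    (G.neighborSet t).ncard = 3 ↔ ∃ a b c, a ≠ b ∧ a ≠ c ∧ b ≠ c ∧
      ∀ z, G.Adj t z ↔ z = a ∨ z = b ∨ z = c := by
  simp only [Set.ncard_eq_three, Set.ext_iff, mem_neighborSet, Set.mem_insert_iff,
    Set.mem_singleton_iff]

theorem four_le_ncard_neighborSet {V : Type*} [Finite V] {G : SimpleGraph V} {t a b c d : V}
    (ha : G.Adj t a) (hb : G.Adj t b) (hc : G.Adj t c) (hd : G.Adj t d) (hab : a ≠ b)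
    (hac : a ≠ c) (had : a ≠ d) (hbc : b ≠ c) (hbd : b ≠ d) (hcd : c ≠ d) :
    4 ≤ (G.neighborSet t).ncard := by
  have h : ({a, b, c, d} : Set V) ⊆ G.neighborSet t := by
    rintro x (rfl | rfl | rfl | rfl) <;> assumption
  refine le_trans (le_of_eq ?_) (Set.ncard_le_ncard h)
  rw [Set.ncard_insert_of_notMem (by simp [hab, hac, had]),
    Set.ncard_insert_of_notMem (by simp [hbc, hbd]), Set.ncard_pair hcd]

theorem NoSmallCut.not_splitEdge_of_triangle {V : Type*} {G : SimpleGraph V} (hG : NoSmallCut G)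
    {u v t : V} (h : SplitEdge G u v) (hu : G.Adj t u) (hv : G.Adj t v)
    (ht : (G.neighborSet t).ncard = 3) : False := by
  obtain ⟨hadj, X, Y, p, q, huX, hvY, hXY, hpX, hpY, hqX, hqY, hcov, he, hX, hY⟩ := h
  obtain ⟨w, hwu, hwv, hw⟩ := exists_third (ncard_neighborSet_eq_three_iff.mp ht) hu hv hadj.ne
  have htpq : ∃ z, z ∉ X ∧ z ∉ Y ∧ t ∉ X ∧ t ∉ Y ∧ ∀ y, y ∈ X ∨ y ∈ Y ∨ y = t ∨ y = z := by
    have htX : t ∉ X := fun htX => hu.ne (he t htX v hvY hv).1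
    have htY : t ∉ Y := fun htY => hv.ne (he u huX t htY hu.symm).2
    rcases hcov t with h | h | h | h
    · exact absurd h htX
    · exact absurd h htY
    · subst h; exact ⟨q, hqX, hqY, htX, htY, hcov⟩
    · subst h; exact ⟨p, hpX, hpY, htX, htY, fun y => by have := hcov y; tauto⟩
  obtain ⟨z, hzX, hzY, htX, htY, hcov'⟩ := htpq
  by_cases hwY : w ∈ Y
  · obtain ⟨x, hx, hxu⟩ := hX
    have := hG (X \ {u}) u z ⟨x, hx, hxu⟩ (by
      rintro a ⟨ha, hau⟩ b hab
      have h1 := he a ha b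
      have h2 := hw a
      have h3 := hcov' b
      have := hXY a ha
      simp only [Set.mem_sdiff, Set.mem_singleton_iff] at *
      grind [SimpleGraph.Adj.symm]) v
    have := hadj.ne
    simp only [Set.mem_sdiff, Set.mem_singleton_iff] at *
    grind
  · obtain ⟨x, hx, hxu⟩ := hY
    have := hG (Y \ {v}) v z ⟨x, hx, hxu⟩ (by
      rintro a ⟨ha, hau⟩ b hab
      have h1 := fun hb => he b hb a ha hab.symm
      have h2 := hw a
      have h3 := hcov' b
      have := hXY a
      simp only [Set.mem_sdiff, Set.mem_singleton_iff] at *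
      grind [SimpleGraph.Adj.symm]) u
    have := hadj.ne
    simp only [Set.mem_sdiff, Set.mem_singleton_iff] at *
    grind

/-- Disjoint vertex sets `P`, `Q` such that the edges between them together with the remaining
vertices form a minimal separator of size three. -/
structure MixedCut {V : Type*} (G : SimpleGraph V) (P Q : Set V) : Prop where
  disjoint : ∀ x ∈ P, x ∉ Q
  nontrivial_left : P.Nontrivial
  nontrivial_right : Q.Nontrivial
  exists_adj : ∃ x ∈ P, ∃ y ∈ Q, G.Adj x y
  two_left : ∀ s, s ∉ P → s ∉ Q → ∃ x ∈ P, ∃ y ∈ P, x ≠ y ∧ G.Adj s x ∧ G.Adj s y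
  two_right : ∀ s, s ∉ P → s ∉ Q → ∃ x ∈ Q, ∃ y ∈ Q, x ≠ y ∧ G.Adj s x ∧ G.Adj s y
  unique_left : ∀ z ∈ P, ∀ x ∈ Q, ∀ y ∈ Q, G.Adj z x → G.Adj z y → x = y
  unique_right : ∀ z ∈ Q, ∀ x ∈ P, ∀ y ∈ P, G.Adj z x → G.Adj z y → x = y
  boundary_left : ∃ a b c, a ≠ b ∧ a ≠ c ∧ b ≠ c ∧
    ∀ z, (z ∉ Q ∧ ∃ y ∈ Q, G.Adj z y) ↔ z = a ∨ z = b ∨ z = c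
  boundary_right : ∃ a b c, a ≠ b ∧ a ≠ c ∧ b ≠ c ∧
    ∀ z, (z ∉ P ∧ ∃ y ∈ P, G.Adj z y) ↔ z = a ∨ z = b ∨ z = c

theorem MixedCut.symm {V : Type*} {G : SimpleGraph V} {P Q : Set V} (h : MixedCut G P Q) :
    MixedCut G Q P where
  disjoint x hx hx' := h.disjoint x hx' hx
  nontrivial_left := h.nontrivial_right
  nontrivial_right := h.nontrivial_left
  exists_adj := let ⟨x, hx, y, hy, hxy⟩ := h.exists_adj; ⟨y, hy, x, hx, hxy.symm⟩
  two_left s hs hs' := h.two_right s hs' hs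
  two_right s hs hs' := h.two_left s hs' hs
  unique_left := h.unique_right
  unique_right := h.unique_left
  boundary_left := h.boundary_right
  boundary_right := h.boundary_left

/-- A subset of `Q` with no edges to the rest of `Q` is empty or everything. -/
theorem MixedCut.eq_right_of_closed {V : Type*} {G : SimpleGraph V} {P Q : Set V}
    (h : MixedCut G P Q) (hG : NoSmallCut G) {Z : Set V} (hZQ : ∀ z ∈ Z, z ∈ Q)
    (hZ : Z.Nonempty) (hcl : ∀ x ∈ Z, ∀ y ∈ Q, G.Adj x y → y ∈ Z) : ∀ y ∈ Q, y ∈ Z := by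
  have key : ∀ Z' : Set V, (∀ z ∈ Z', z ∈ Q) → Z'.Nonempty →
      (∀ x ∈ Z', ∀ y ∈ Q, G.Adj x y → y ∈ Z') → ∀ x ∈ P, ∀ y ∈ Q, G.Adj x y → y ∈ Z' := by
    intro Z' hZQ' hne hcl' x hx y hy hxy
    by_contra hyZ
    obtain ⟨a, b, c, hab, hac, hbc, hN⟩ := h.boundary_left
    have hxd := h.disjoint x hx
    have h1 : ∃ p q, p ≠ x ∧ q ≠ x ∧ ∀ z, z ∉ Q → ∀ w ∈ Q, G.Adj z w → z = x ∨ z = p ∨ z = q := by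
      have := (hN x).mp ⟨hxd, y, hy, hxy⟩
      rcases this with rfl | rfl | rfl
      · exact ⟨b, c, hab.symm, hac.symm, fun z hz w hw hzw => (hN z).mp ⟨hz, w, hw, hzw⟩⟩
      · exact ⟨a, c, hab, hbc.symm, fun z hz w hw hzw => by
          have := (hN z).mp ⟨hz, w, hw, hzw⟩; tauto⟩
      · exact ⟨a, b, hac, hbc, fun z hz w hw hzw => by
          have := (hN z).mp ⟨hz, w, hw, hzw⟩; tauto⟩
    obtain ⟨p, q, hp, hq, hpq⟩ := h1
    have := hG Z' p q hne (by
      intro a ha b hab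
      by_cases hb : b ∈ Q
      · exact Or.inl (hcl' a ha b hb hab)
      · rcases hpq b hb a (hZQ' a ha) hab.symm with rfl | h2 | h2
        · exact absurd (h.unique_left b hx a (hZQ' a ha) y hy hab.symm hxy ▸ ha) hyZ
        · exact Or.inr (Or.inl h2)
        · exact Or.inr (Or.inr h2)) x
    rcases this with h2 | h2 | h2
    · exact hxd (hZQ' x h2)
    · exact hp h2.symm
    · exact hq h2.symm
  obtain ⟨x, hx, y, hy, hxy⟩ := h.exists_adj
  by_contra! hcon
  obtain ⟨w, hw, hwZ⟩ := hcon
  have h1 := key Z hZQ hZ hcl x hx y hy hxy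
  have h2 := key (Q \ Z) (fun z hz => hz.1) ⟨w, hw, hwZ⟩
    (fun a ha b hb hab => ⟨hb, fun hbZ => ha.2 (hcl b hbZ a ha.1 hab.symm)⟩) x hx y hy hxy
  exact h2.2 h1

/-- Disjoint nontrivial sets `P`, `Q` for which the edges between them (listed as pairs
`l i`, `r i`) and the remaining vertices (listed with `l i = r i`) are at most three in total. -/
structure WeakCut {V : Type*} (G : SimpleGraph V) (P Q : Set V) (l r : Fin 3 → V) : Prop where
  disjoint : ∀ x ∈ P, x ∉ Q
  nontrivial_left : P.Nontrivial
  nontrivial_right : Q.Nontrivial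
  exists_adj : ∃ x ∈ P, ∃ y ∈ Q, G.Adj x y
  edge : ∀ x ∈ P, ∀ y ∈ Q, G.Adj x y → ∃ i, l i = x ∧ r i = y
  vertex : ∀ s, s ∉ P → s ∉ Q → ∃ i, l i = s ∧ r i = s

theorem WeakCut.symm {V : Type*} {G : SimpleGraph V} {P Q : Set V} {l r : Fin 3 → V}
    (h : WeakCut G P Q l r) : WeakCut G Q P r l where
  disjoint x hx hx' := h.disjoint x hx' hx
  nontrivial_left := h.nontrivial_right
  nontrivial_right := h.nontrivial_left
  exists_adj := let ⟨x, hx, y, hy, hxy⟩ := h.exists_adj; ⟨y, hy, x, hx, hxy.symm⟩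
  edge x hx y hy hxy := let ⟨i, h1, h2⟩ := h.edge y hy x hx hxy.symm; ⟨i, h2, h1⟩
  vertex s hs hs' := let ⟨i, h1, h2⟩ := h.vertex s hs' hs; ⟨i, h2, h1⟩

theorem WeakCut.insert_right {V : Type*} {G : SimpleGraph V} {P Q : Set V} {l r : Fin 3 → V}
    (h : WeakCut G P Q l r) {s : V} (hP : s ∉ P) (hQ : s ∉ Q)
    (hs : ∀ x ∈ P, ∀ y ∈ P, G.Adj s x → G.Adj s y → x = y) :
    ∃ l', WeakCut G P (insert s Q) l' r := by
  obtain ⟨i, hil, hir⟩ := h.vertex s hP hQ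
  obtain ⟨n, hn⟩ : ∃ n, ∀ x ∈ P, G.Adj s x → x = n := by
    by_cases hex : ∃ x ∈ P, G.Adj s x
    · obtain ⟨n, hnP, hn⟩ := hex
      exact ⟨n, fun x hx hsx => hs x hx n hnP hsx hn⟩
    · exact ⟨s, fun x hx hsx => absurd ⟨x, hx, hsx⟩ hex⟩
  refine ⟨Function.update l i n, ⟨fun x hx => ?_, h.nontrivial_left,
    h.nontrivial_right.mono (Set.subset_insert _ _), ?_, fun x hx y hy hxy => ?_,
    fun t ht ht' => ?_⟩⟩
  · rintro (rfl | h')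
    · exact hP hx
    · exact h.disjoint x hx h'
  · obtain ⟨x, hx, y, hy, hxy⟩ := h.exists_adj
    exact ⟨x, hx, y, Or.inr hy, hxy⟩
  · rcases hy with rfl | hy
    · exact ⟨i, by simp [hn x hx hxy.symm], hir⟩
    · obtain ⟨j, hj, hj'⟩ := h.edge x hx y hy hxy
      have hji : j ≠ i := by
        rintro rfl
        exact hQ (by rw [← hir, hj']; exact hy)
      exact ⟨j, by simp [hji, hj], hj'⟩
  · obtain ⟨j, hj, hj'⟩ := h.vertex t ht fun h' => ht' (Or.inr h')
    have hji : j ≠ i := by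
      rintro rfl
      exact ht' (Or.inl (by rw [← hj', hir]))
    exact ⟨j, by simp [hji, hj], hj'⟩

theorem WeakCut.unique_left {V : Type*} {G : SimpleGraph V} {P Q : Set V} {l r : Fin 3 → V}
    (h : WeakCut G P Q l r) (hG : NoSmallCut G) :
    ∀ z ∈ P, ∀ x ∈ Q, ∀ y ∈ Q, G.Adj z x → G.Adj z y → x = y := by
  intro z hz x hx y hy hzx hzy
  by_contra hxy
  obtain ⟨i, hi, hi'⟩ := h.edge z hz x hx hzx
  obtain ⟨j, hj, hj'⟩ := h.edge z hz y hy hzy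
  have hij : i ≠ j := by
    rintro rfl
    exact hxy (hi'.symm.trans hj')
  obtain ⟨k, hk⟩ : ∃ k : Fin 3, ∀ m, m = i ∨ m = j ∨ m = k :=
    (by decide : ∀ i j : Fin 3, i ≠ j → ∃ k : Fin 3, ∀ m, m = i ∨ m = j ∨ m = k) i j hij
  obtain ⟨w, hw, hwz⟩ := h.nontrivial_left.exists_ne z
  have key := hG (P \ {z}) z (r k) ⟨w, hw, hwz⟩ (by
    rintro a ⟨ha, haz⟩ b hab
    simp only [Set.mem_singleton_iff] at haz
    by_cases hb : b ∈ P
    · by_cases hbz : b = z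
      · exact Or.inr (Or.inl hbz)
      · exact Or.inl ⟨hb, hbz⟩
    · right; right
      by_cases hb' : b ∈ Q
      · obtain ⟨m, hm, hm'⟩ := h.edge a ha b hb' hab
        rcases hk m with rfl | rfl | rfl
        · exact absurd (hm.symm.trans hi) haz
        · exact absurd (hm.symm.trans hj) haz
        · exact hm'.symm
      · obtain ⟨m, hm, hm'⟩ := h.vertex b hb hb'
        rcases hk m with rfl | rfl | rfl
        · exact absurd (by rwa [← hm, hi]) hb
        · exact absurd (by rwa [← hm, hj]) hb
        · exact hm'.symm)
  have hout : ∀ u ∈ Q, u = r k := fun u hu => by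
    rcases key u with h1 | h1 | h1
    · exact absurd hu (h.disjoint u h1.1)
    · exact absurd hu (h.disjoint u (h1 ▸ hz))
    · exact h1
  exact hxy ((hout x hx).trans (hout y hy).symm)

theorem WeakCut.boundary_left {V : Type*} [Finite V] {G : SimpleGraph V} {P Q : Set V}
    {l r : Fin 3 → V} (h : WeakCut G P Q l r) (hG : NoSmallCut G) (hcard : 3 < Nat.card V) :
    ∃ a b c, a ≠ b ∧ a ≠ c ∧ b ≠ c ∧
      ∀ z, (z ∉ Q ∧ ∃ y ∈ Q, G.Adj z y) ↔ z = a ∨ z = b ∨ z = c := by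
  have two : ∀ j k, ¬ ∀ z, (z ∉ Q ∧ ∃ y ∈ Q, G.Adj z y) → z = j ∨ z = k := by
    intro j k hjk
    have key := hG Q j k h.nontrivial_right.nonempty (by
      intro x hx y hxy
      by_cases hy : y ∈ Q
      · exact Or.inl hy
      · exact Or.inr (hjk y ⟨hy, x, hx, hxy.symm⟩))
    obtain ⟨p₁, hp₁, p₂, hp₂, hne⟩ := h.nontrivial_left
    have h1 := key p₁
    have h2 := key p₂
    have h3 := h.disjoint p₁ hp₁
    have h4 := h.disjoint p₂ hp₂
    obtain ⟨z, hz, hzp, -⟩ := hG.exists_adj_ne hcard p₁ p₂ p₂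
    obtain ⟨z', hz', hzp', hzz⟩ := hG.exists_adj_ne hcard p₁ p₂ z
    have h5 := key z
    have h6 := key z'
    have h7 := hz.ne
    have h8 := hz'.ne
    refine hzz (h.unique_left hG p₁ hp₁ z' ?_ z ?_ hz' hz) <;> grind
  have sub : ∀ z, (z ∉ Q ∧ ∃ y ∈ Q, G.Adj z y) → z = l 0 ∨ z = l 1 ∨ z = l 2 := by
    rintro z ⟨hz, y, hy, hzy⟩
    have : ∃ i, l i = z := by
      by_cases hzP : z ∈ P
      · obtain ⟨i, hi, -⟩ := h.edge z hzP y hy hzy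
        exact ⟨i, hi⟩
      · obtain ⟨i, hi, -⟩ := h.vertex z hzP hz
        exact ⟨i, hi⟩
    obtain ⟨i, rfl⟩ := this
    fin_cases i <;> simp
  refine ⟨l 0, l 1, l 2, fun h' => two (l 0) (l 2) ?_, fun h' => two (l 0) (l 1) ?_,
    fun h' => two (l 0) (l 1) ?_, fun z => ⟨sub z, ?_⟩⟩
  · intro z hz; have := sub z hz; grind
  · intro z hz; have := sub z hz; grind
  · intro z hz; have := sub z hz; grind
  · intro hz
    by_contra hcon
    rcases hz with rfl | rfl | rfl
    · exact two (l 1) (l 2) fun z hz => by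
        rcases sub z hz with rfl | h' | h'
        · exact absurd hz hcon
        · exact Or.inl h'
        · exact Or.inr h'
    · exact two (l 0) (l 2) fun z hz => by
        rcases sub z hz with h' | rfl | h'
        · exact Or.inl h'
        · exact absurd hz hcon
        · exact Or.inr h'
    · exact two (l 0) (l 1) fun z hz => by
        rcases sub z hz with h' | h' | rfl
        · exact Or.inl h'
        · exact Or.inr h'
        · exact absurd hz hcon

theorem WeakCut.exists_mixedCut {V : Type*} [Finite V] {G : SimpleGraph V} (hG : NoSmallCut G)
    (hcard : 3 < Nat.card V) (n : ℕ) : ∀ (P Q : Set V) (l r : Fin 3 → V), WeakCut G P Q l r →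
    (P ∪ Q)ᶜ.ncard = n → ∃ P Q, MixedCut G P Q := by
  induction n using Nat.strong_induction_on with
  | _ n ih =>
  intro P Q l r h hn
  have step : ∀ (P Q : Set V) (l r : Fin 3 → V), WeakCut G P Q l r → (P ∪ Q)ᶜ.ncard = n →
      (∃ P Q, MixedCut G P Q) ∨
        ∀ s, s ∉ P → s ∉ Q → ∃ x ∈ P, ∃ y ∈ P, x ≠ y ∧ G.Adj s x ∧ G.Adj s y := by
    intro P Q l r h hn
    refine or_iff_not_imp_right.mpr fun hcon => ?_
    push Not at hcon
    obtain ⟨s, hsP, hsQ, hs⟩ := hcon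
    obtain ⟨l', hl'⟩ := h.insert_right hsP hsQ fun x hx y hy hsx hsy =>
      by_contra fun hxy => hs x hx y hy hxy hsx hsy
    refine ih _ ?_ P (insert s Q) l' r hl' rfl
    rw [← hn]
    refine Set.ncard_lt_ncard ⟨?_, fun hsub => ?_⟩
    · intro x hx
      simp only [Set.mem_compl_iff, Set.mem_union, Set.mem_insert_iff] at *
      tauto
    · have : s ∈ (P ∪ insert s Q)ᶜ := hsub (by simp [hsP, hsQ])
      simp at this
  rcases step P Q l r h hn with h1 | h1
  · exact h1
  rcases step Q P r l h.symm (by rwa [Set.union_comm]) with h2 | h2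
  · exact h2
  exact ⟨P, Q, h.disjoint, h.nontrivial_left, h.nontrivial_right, h.exists_adj, h1,
    fun s hP hQ => h2 s hQ hP, h.unique_left hG, h.symm.unique_left hG,
    h.boundary_left hG hcard, h.symm.boundary_left hG hcard⟩

theorem SplitEdge.exists_mixedCut {V : Type*} [Finite V] {G : SimpleGraph V} {u v : V}
    (h : SplitEdge G u v) (hG : NoSmallCut G) (hcard : 3 < Nat.card V) :
    ∃ P Q, MixedCut G P Q := by
  obtain ⟨hadj, X, Y, p, q, huX, hvY, hXY, hpX, hpY, hqX, hqY, hcov, he, hX, hY⟩ := h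
  obtain ⟨x, hx, hxu⟩ := hX
  obtain ⟨y, hy, hyv⟩ := hY
  refine WeakCut.exists_mixedCut hG hcard _ X Y ![u, p, q] ![v, p, q]
    ⟨hXY, ⟨x, hx, u, huX, hxu⟩, ⟨y, hy, v, hvY, hyv⟩, ⟨u, huX, v, hvY, hadj⟩, ?_, ?_⟩ rfl
  · intro a ha b hb hab
    obtain ⟨rfl, rfl⟩ := he a ha b hb hab
    exact ⟨0, rfl, rfl⟩
  · intro s hsX hsY
    rcases hcov s with h | h | rfl | rfl
    · exact absurd h hsX
    · exact absurd h hsY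
    · exact ⟨1, rfl, rfl⟩
    · exact ⟨2, rfl, rfl⟩

theorem MixedCut.exists_adj_notMem {V : Type*} [Finite V] {G : SimpleGraph V} {P Q : Set V}
    (h : MixedCut G P Q) (hG : NoSmallCut G) (hcard : 3 < Nat.card V) {v : V} (hv : v ∉ Q)
    (w : V) : ∃ z, z ∉ Q ∧ G.Adj v z ∧ z ≠ w := by
  by_cases hP : v ∈ P
  · by_cases hy : ∃ y ∈ Q, G.Adj v y
    · obtain ⟨y, hy, hvy⟩ := hy
      obtain ⟨z, hz, hzw, hzy⟩ := hG.exists_adj_ne hcard v w y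
      exact ⟨z, fun hzQ => hzy (h.unique_left v hP z hzQ y hy hz hvy), hz, hzw⟩
    · obtain ⟨z, hz, hzw, -⟩ := hG.exists_adj_ne hcard v w w
      exact ⟨z, fun hzQ => hy ⟨z, hzQ, hz⟩, hz, hzw⟩
  · obtain ⟨x, hx, y, hy, hxy, hvx, hvy⟩ := h.two_left v hP hv
    by_cases hxw : x = w
    · exact ⟨y, h.disjoint y hy, hvy, fun hyw => hxy (hxw.trans hyw.symm)⟩
    · exact ⟨x, h.disjoint x hx, hvx, hxw⟩

/-- No two-vertex set consisting of the contracted vertex and another one separates the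
contraction of `Q`. -/
theorem MixedCut.eq_univ_of_closed {V : Type*} [Finite V] {G : SimpleGraph V} {P Q : Set V}
    (h : MixedCut G P Q) (hG : NoSmallCut G) (hcard : 3 < Nat.card V) {A : Set V} {q : V}
    (hA : A.Nonempty) (hAQ : ∀ x ∈ A, x ∉ Q) (hq : q ∉ Q)
    (hcl : ∀ x ∈ A, ∀ y, G.Adj x y → y ∈ A ∨ y ∈ Q ∨ y = q) (y : V) :
    y ∈ A ∨ y ∈ Q ∨ y = q := by
  by_contra! hy
  have key : ∀ (C : Set V) (s : V), C.Nonempty → q ∉ C → (∀ x ∈ C, x ∉ Q) →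
      (∀ x ∈ C, ∀ y, G.Adj x y → y ∈ C ∨ y ∈ Q ∨ y = q) →
      ¬ ∀ z ∈ C, ∀ y ∈ Q, G.Adj z y → z = s := by
    intro C s ⟨c, hc⟩ hqC hCQ hCcl hs
    have hne : (C \ {s}).Nonempty := by
      by_contra hemp
      have hCs : ∀ x ∈ C, x = s := fun x hx => by_contra fun hxs => hemp ⟨x, hx, hxs⟩
      obtain ⟨z, hzQ, hcz, hzq⟩ := h.exists_adj_notMem hG hcard (hCQ c hc) q
      rcases hCcl c hc z hcz with h1 | h1 | h1
      · exact hcz.ne ((hCs c hc).trans (hCs z h1).symm)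
      · exact hzQ h1
      · exact hzq h1
    have hcov := hG (C \ {s}) s q hne (by
      rintro x ⟨hx, hxs⟩ y hxy
      rcases hCcl x hx y hxy with h1 | h1 | h1
      · by_cases hys : y = s
        · exact Or.inr (Or.inl hys)
        · exact Or.inl ⟨h1, hys⟩
      · exact absurd (hs x hx y h1 hxy) hxs
      · exact Or.inr (Or.inr h1))
    have hQs : ∀ x ∈ Q, x = s := fun x hx => by
      rcases hcov x with h1 | h1 | h1
      · exact absurd hx (hCQ x h1.1)
      · exact h1
      · exact absurd (h1 ▸ hx) hq
    obtain ⟨x, hx, y, hy, hxy⟩ := h.nontrivial_right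
    exact hxy ((hQs x hx).trans (hQs y hy).symm)
  obtain ⟨a, b, c, hab, hac, hbc, hN⟩ := h.boundary_left
  have hd : ∀ z, z ∉ Q → ∀ y ∈ Q, G.Adj z y → z = a ∨ z = b ∨ z = c :=
    fun z hz y hy hzy => (hN z).mp ⟨hz, y, hy, hzy⟩
  have k1 := fun s => key (A \ {q}) s (by
      obtain ⟨x, hx⟩ := hA
      by_cases hxq : x = q
      · obtain ⟨z, hzQ, hxz, hzq⟩ := h.exists_adj_notMem hG hcard (hAQ x hx) q
        rcases hcl x hx z hxz with h1 | h1 | h1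
        · exact ⟨z, h1, hzq⟩
        · exact absurd h1 hzQ
        · exact absurd h1 hzq
      · exact ⟨x, hx, hxq⟩) (fun hqA => hqA.2 rfl) (fun x hx => hAQ x hx.1) (by
      rintro x ⟨hx, -⟩ y hxy
      rcases hcl x hx y hxy with h1 | h1 | h1
      · by_cases hyq : y = q
        · exact Or.inr (Or.inr hyq)
        · exact Or.inl ⟨h1, hyq⟩
      · exact Or.inr (Or.inl h1)
      · exact Or.inr (Or.inr h1))
  have k2 := fun s => key {z | z ∉ A ∧ z ∉ Q ∧ z ≠ q} s ⟨y, hy⟩ (fun hqZ => hqZ.2.2 rfl)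
    (fun x hx => hx.2.1) (by
      rintro x ⟨hxA, hxQ, hxq⟩ z hxz
      by_cases hzA : z ∈ A
      · rcases hcl z hzA x hxz.symm with h1 | h1 | h1
        · exact absurd h1 hxA
        · exact absurd h1 hxQ
        · exact absurd h1 hxq
      · by_cases hzQ : z ∈ Q
        · exact Or.inr (Or.inl hzQ)
        · by_cases hzq : z = q
          · exact Or.inr (Or.inr hzq)
          · exact Or.inl ⟨hzA, hzQ, hzq⟩)
  have l1 : ∀ s, ¬ ∀ z, (z = a ∨ z = b ∨ z = c) → z ∈ A → z = s := fun s hs =>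
    k1 s fun z hz y hy hzy => hs z (hd z (hAQ z hz.1) y hy hzy) hz.1
  have l2 : ∀ s, ¬ ∀ z, (z = a ∨ z = b ∨ z = c) → z ∉ A → z = s := fun s hs =>
    k2 s fun z hz y hy hzy => hs z (hd z hz.2.1 y hy hzy) hz.1
  by_cases ha : a ∈ A <;> by_cases hb : b ∈ A <;> by_cases hc : c ∈ A
  · exact l2 a (by grind)
  · exact l2 c (by grind)
  · exact l2 b (by grind)
  · exact l1 a (by grind)
  · exact l2 a (by grind)
  · exact l1 b (by grind)
  · exact l1 c (by grind)
  · exact l1 a (by grind)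

/-- Contract the set `Q` to the single vertex `none`. -/
def contract {V : Type*} (G : SimpleGraph V) (Q : Set V) : SimpleGraph (Option {v // v ∉ Q}) where
  Adj
    | some u, some v => G.Adj u v
    | some u, none => ∃ y ∈ Q, G.Adj u y
    | none, some v => ∃ y ∈ Q, G.Adj v y
    | none, none => False
  symm := ⟨by
    rintro (_ | u) (_ | v) h
    · exact h
    · exact h
    · exact h
    · exact G.symm.symm _ _ h⟩
  loopless := ⟨by
    rintro (_ | u) h
    · exact h
    · exact G.loopless.irrefl _ h⟩

theorem MixedCut.noSmallCut_contract {V : Type*} [Finite V] {G : SimpleGraph V} {P Q : Set V}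
    (h : MixedCut G P Q) (hG : NoSmallCut G) (hcard : 3 < Nat.card V) :
    NoSmallCut (contract G Q) := by
  have caseB : ∀ (X : Set (Option {v // v ∉ Q})) (q : Option {v // v ∉ Q}), X.Nonempty →
      none ∉ X → (∀ x ∈ X, ∀ y, (contract G Q).Adj x y → y ∈ X ∨ y = none ∨ y = q) →
      ∀ y, y ∈ X ∨ y = none ∨ y = q := by
    intro X q hX hnone hcl
    have hX' : ∃ x, some x ∈ X := by
      obtain ⟨_ | x, hx⟩ := hX
      · exact absurd hx hnone
      · exact ⟨x, hx⟩
    obtain ⟨q', hq1, hq2⟩ : ∃ q' : {v // v ∉ Q}, (q = none ∨ q = some q') ∧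
        (q = some q' ∨ some q' ∈ X) := by
      rcases q with _ | q
      · obtain ⟨x, hx⟩ := hX'
        exact ⟨x, Or.inl rfl, Or.inr hx⟩
      · exact ⟨q, Or.inr rfl, Or.inl rfl⟩
    have key := h.eq_univ_of_closed hG hcard (A := {v | ∃ hv : v ∉ Q, some ⟨v, hv⟩ ∈ X})
      (q := q') (by obtain ⟨x, hx⟩ := hX'; exact ⟨x, x.2, hx⟩) (fun x hx => hx.1) q'.2 (by
        rintro x ⟨hxQ, hx⟩ y hxy
        by_cases hy : y ∈ Q
        · exact Or.inr (Or.inl hy)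
        · rcases hcl _ hx (some ⟨y, hy⟩) hxy with h1 | h1 | h1
          · exact Or.inl ⟨hy, h1⟩
          · simp at h1
          · rcases hq1 with h2 | h2
            · simp [h2] at h1
            · rw [h2, Option.some_inj] at h1
              exact Or.inr (Or.inr (by rw [← h1])))
    rintro (_ | y)
    · exact Or.inr (Or.inl rfl)
    · rcases key y with ⟨_, h1⟩ | h1 | h1
      · exact Or.inl h1
      · exact absurd h1 y.2
      · have h2 : y = q' := Subtype.ext h1
        subst h2
        rcases hq2 with h3 | h3
        · exact Or.inr (Or.inr h3.symm)
        · exact Or.inl h3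
  intro X p q hX hcl
  obtain ⟨y₀, hy₀⟩ := h.nontrivial_right.nonempty
  by_cases hp : p = none ∧ none ∉ X
  · obtain ⟨rfl, hn⟩ := hp
    exact caseB X q hX hn hcl
  by_cases hq : q = none ∧ none ∉ X
  · obtain ⟨rfl, hn⟩ := hq
    intro y
    have := caseB X p hX hn (fun x hx y hxy => by have := hcl x hx y hxy; tauto) y
    tauto
  have lift : ∀ p : Option {v // v ∉ Q}, ¬ (p = none ∧ none ∉ X) → ∃ p' : V,
      (p = none ∧ none ∈ X ∧ p' ∈ Q) ∨ (∃ hp : p' ∉ Q, p = some ⟨p', hp⟩) := by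
    rintro (_ | p) hp
    · exact ⟨y₀, Or.inl ⟨rfl, by simpa using hp, hy₀⟩⟩
    · exact ⟨p, Or.inr ⟨p.2, rfl⟩⟩
  obtain ⟨p', hp'⟩ := lift p hp
  obtain ⟨q', hq'⟩ := lift q hq
  have lower : ∀ {y : V} (hy : y ∉ Q), (some ⟨y, hy⟩ ∈ X ∨ some ⟨y, hy⟩ = p ∨ some ⟨y, hy⟩ = q) ↔
      some ⟨y, hy⟩ ∈ X ∨ y = p' ∨ y = q' := by
    intro y hy
    refine or_congr Iff.rfl (or_congr ?_ ?_)
    · rcases hp' with ⟨rfl, -, h1⟩ | ⟨h1, rfl⟩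
      · simp only [reduceCtorEq, false_iff]; rintro rfl; exact hy h1
      · simp
    · rcases hq' with ⟨rfl, -, h1⟩ | ⟨h1, rfl⟩
      · simp only [reduceCtorEq, false_iff]; rintro rfl; exact hy h1
      · simp
  have hnone : (none ∈ X ∨ none = p ∨ none = q) → none ∈ X := by
    rintro (h1 | rfl | rfl)
    · exact h1
    · simpa using hp
    · simpa using hq
  have key := hG {v | (v ∈ Q ∧ none ∈ X) ∨ ∃ hv : v ∉ Q, some ⟨v, hv⟩ ∈ X} p' q' (by
      obtain ⟨_ | x, hx⟩ := hX
      · exact ⟨y₀, Or.inl ⟨hy₀, hx⟩⟩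
      · exact ⟨x, Or.inr ⟨x.2, hx⟩⟩) (by
      rintro x (⟨hxQ, hx⟩ | ⟨hxQ, hx⟩) y hxy
      · by_cases hy : y ∈ Q
        · exact Or.inl (Or.inl ⟨hy, hx⟩)
        · rcases (lower hy).mp (hcl _ hx (some ⟨y, hy⟩) ⟨x, hxQ, hxy.symm⟩) with h1 | h1
          · exact Or.inl (Or.inr ⟨hy, h1⟩)
          · exact Or.inr h1
      · by_cases hy : y ∈ Q
        · exact Or.inl (Or.inl ⟨hy, hnone (hcl _ hx none ⟨y, hy, hxy⟩)⟩)
        · rcases (lower hy).mp (hcl _ hx (some ⟨y, hy⟩) hxy) with h1 | h1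
          · exact Or.inl (Or.inr ⟨hy, h1⟩)
          · exact Or.inr h1)
  rintro (_ | ⟨y, hy⟩)
  · rcases key y₀ with (⟨-, h1⟩ | ⟨h1, -⟩) | rfl | rfl
    · exact Or.inl h1
    · exact absurd hy₀ h1
    · rcases hp' with ⟨rfl, -, h1⟩ | ⟨h1, rfl⟩
      · exact Or.inr (Or.inl rfl)
      · exact absurd hy₀ h1
    · rcases hq' with ⟨rfl, -, h1⟩ | ⟨h1, rfl⟩
      · exact Or.inr (Or.inr rfl)
      · exact absurd hy₀ h1
  · rcases key y with (⟨h1, -⟩ | ⟨_, h1⟩) | h1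
    · exact absurd h1 hy
    · exact Or.inl h1
    · exact (lower hy).mpr (Or.inr h1)

theorem MixedCut.ncard_neighborSet_contract_some {V : Type*} {G : SimpleGraph V} {P Q : Set V}
    (h : MixedCut G P Q) {v : V} (hP : v ∈ P) (hQ : v ∉ Q) :
    ((contract G Q).neighborSet (some ⟨v, hQ⟩)).ncard = (G.neighborSet v).ncard := by
  classical
  let φ : V → Option {v // v ∉ Q} := fun x => if hx : x ∈ Q then none else some ⟨x, hx⟩
  have himage : (contract G Q).neighborSet (some ⟨v, hQ⟩) = φ '' G.neighborSet v := by
    ext (_ | ⟨y, hy⟩)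
    · constructor
      · rintro ⟨y, hy, hvy⟩
        exact ⟨y, hvy, by simp [φ, hy]⟩
      · rintro ⟨y, hvy, hy⟩
        refine ⟨y, ?_, hvy⟩
        by_contra hyQ
        simp [φ, hyQ] at hy
    · constructor
      · intro hvy
        exact ⟨y, hvy, by simp [φ, hy]⟩
      · rintro ⟨z, hvz, hz⟩
        by_cases hzQ : z ∈ Q
        · simp [φ, hzQ] at hz
        · simp only [φ, hzQ, dite_false, Option.some_inj, Subtype.mk.injEq] at hz
          subst hz
          exact hvz
  rw [himage]
  refine Set.InjOn.ncard_image fun x hx y hy hxy => ?_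
  by_cases hxQ : x ∈ Q <;> by_cases hyQ : y ∈ Q
  · exact h.unique_left v hP x hxQ y hyQ hx hy
  · simp [φ, hxQ, hyQ] at hxy
  · simp [φ, hxQ, hyQ] at hxy
  · simpa [φ, hxQ, hyQ] using hxy

theorem MixedCut.ncard_neighborSet_contract_none {V : Type*} {G : SimpleGraph V} {P Q : Set V}
    (h : MixedCut G P Q) : ((contract G Q).neighborSet none).ncard = 3 := by
  obtain ⟨a, b, c, hab, hac, hbc, hN⟩ := h.boundary_left
  have ha := ((hN a).mpr (Or.inl rfl)).1
  have hb := ((hN b).mpr (Or.inr (Or.inl rfl))).1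
  have hc := ((hN c).mpr (Or.inr (Or.inr rfl))).1
  rw [ncard_neighborSet_eq_three_iff]
  refine ⟨some ⟨a, ha⟩, some ⟨b, hb⟩, some ⟨c, hc⟩, by simpa, by simpa, by simpa, ?_⟩
  rintro (_ | ⟨z, hz⟩)
  · simp
  · simpa [hz, contract] using hN z

theorem MixedCut.card_contract {V : Type*} [Finite V] {G : SimpleGraph V} {P Q : Set V}
    (h : MixedCut G P Q) : 3 < Nat.card (Option {v // v ∉ Q}) ∧
      Nat.card (Option {v // v ∉ Q}) < Nat.card V := by
  have h1 : Nat.card {v // v ∉ Q} = (Qᶜ : Set V).ncard := rfl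
  rw [Finite.card_option, h1]
  constructor
  · obtain ⟨a, b, c, hab, hac, hbc, hN⟩ := h.boundary_left
    have hsub : ({a, b, c} : Set V) ⊆ Qᶜ := by
      rintro z hz
      exact ((hN z).mpr hz).1
    have h2 := Set.ncard_le_ncard hsub
    have h3 := Set.ncard_eq_three.mpr ⟨a, b, c, hab, hac, hbc, rfl⟩
    omega
  · have h2 := Set.ncard_add_ncard_compl Q
    have h3 := (Set.one_lt_ncard_iff_nontrivial (s := Q)).mpr h.nontrivial_right
    omega

theorem MixedCut.four_le_ncard_neighborSet {V : Type*} [Finite V] {G : SimpleGraph V}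
    {P Q : Set V} (h : MixedCut G P Q) {s : V} (hP : s ∉ P) (hQ : s ∉ Q) :
    4 ≤ (G.neighborSet s).ncard := by
  obtain ⟨a, ha, b, hb, hab, hsa, hsb⟩ := h.two_left s hP hQ
  obtain ⟨c, hc, d, hd, hcd, hsc, hsd⟩ := h.two_right s hP hQ
  have hne : ∀ {x y : V}, x ∈ P → y ∈ Q → x ≠ y := fun hx hy hxy => h.disjoint _ hx (hxy ▸ hy)
  exact _root_.four_le_ncard_neighborSet hsa hsb hsc hsd hab (hne ha hc) (hne ha hd) (hne hb hc)
    (hne hb hd) hcd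

theorem MixedCut.mem_of_degree {V : Type*} [Finite V] {G : SimpleGraph V} {P Q F : Set V}
    (h : MixedCut G P Q) (hdeg : ∀ v, v ∉ F → (G.neighborSet v).ncard = 3) {s : V} (hP : s ∉ P)
    (hQ : s ∉ Q) : s ∈ F := by
  by_contra hF
  have h4 := h.four_le_ncard_neighborSet hP hQ
  have h3 := hdeg s hF
  omega

theorem splitEdge_contract_of_subset {V : Type*} {G : SimpleGraph V} {Q X Y : Set V} {u v p q : V}
    (hu : u ∉ Q) (hv : v ∉ Q) (hadj : G.Adj u v) (huX : u ∈ X) (hvY : v ∈ Y)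
    (hXY : ∀ x ∈ X, x ∉ Y) (hp : p ∉ Q) (hq : q ∉ Q) (hpX : p ∉ X) (hpY : p ∉ Y) (hqX : q ∉ X)
    (hqY : q ∉ Y) (hcov : ∀ z, z ∈ X ∨ z ∈ Y ∨ z = p ∨ z = q)
    (he : ∀ x ∈ X, ∀ y ∈ Y, G.Adj x y → x = u ∧ y = v) (hQX : ∀ x ∈ Q, x ∈ X)
    (hY : ∃ y ∈ Y, y ≠ v) : SplitEdge (contract G Q) (some ⟨u, hu⟩) (some ⟨v, hv⟩) := by
  have hYQ : ∀ y ∈ Y, y ∉ Q := fun y hy hyQ => hXY y (hQX y hyQ) hy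
  refine ⟨hadj, {o | ∀ x, o = some x → (x : V) ∈ X}, {o | ∃ y, o = some y ∧ (y : V) ∈ Y},
    some ⟨p, hp⟩, some ⟨q, hq⟩, ?_, ⟨_, rfl, hvY⟩, ?_, fun h => hpX (h _ rfl), ?_,
    fun h => hqX (h _ rfl), ?_, ?_, ?_, ⟨none, by simp, by simp⟩, ?_⟩
  · rintro x hx
    rw [Option.some_inj] at hx
    subst hx
    exact huX
  · rintro _ hx ⟨y, rfl, hy⟩
    exact hXY y (hx y rfl) hy
  · rintro ⟨y, hy, hyY⟩
    rw [Option.some_inj] at hy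
    subst hy
    exact hpY hyY
  · rintro ⟨y, hy, hyY⟩
    rw [Option.some_inj] at hy
    subst hy
    exact hqY hyY
  · rintro (_ | ⟨z, hz⟩)
    · exact Or.inl (by simp)
    · rcases hcov z with h1 | h1 | rfl | rfl
      · refine Or.inl fun x hx => ?_
        rw [Option.some_inj] at hx
        exact hx ▸ h1
      · exact Or.inr (Or.inl ⟨_, rfl, h1⟩)
      · exact Or.inr (Or.inr (Or.inl rfl))
      · exact Or.inr (Or.inr (Or.inr rfl))
  · rintro (_ | ⟨x, hxQ⟩) hx _ ⟨⟨y, hyQ⟩, rfl, hy⟩ hxy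
    · obtain ⟨z, hz, hyz⟩ := hxy
      exact absurd ((he z (hQX z hz) y hy hyz.symm).1 ▸ hz) hu
    · have := he x (hx _ rfl) y hy hxy
      simpa using this
  · obtain ⟨y, hy, hyv⟩ := hY
    exact ⟨some ⟨y, hYQ y hy⟩, ⟨_, rfl, hy⟩, by simpa⟩

theorem splitEdge_contract_of_mem {V : Type*} {G : SimpleGraph V} {Q X Y : Set V} {u v p q : V}
    (hu : u ∉ Q) (hv : v ∉ Q) (hadj : G.Adj u v) (huX : u ∈ X) (hvY : v ∈ Y)
    (hXY : ∀ x ∈ X, x ∉ Y) (hp : p ∈ Q) (hq : q ∉ Q) (hqX : q ∉ X)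
    (hqY : q ∉ Y) (hcov : ∀ z, z ∈ X ∨ z ∈ Y ∨ z = p ∨ z = q)
    (he : ∀ x ∈ X, ∀ y ∈ Y, G.Adj x y → x = u ∧ y = v) (hX : ∃ x ∈ X, x ∉ Q ∧ x ≠ u)
    (hY : ∃ y ∈ Y, y ∉ Q ∧ y ≠ v) :
    SplitEdge (contract G Q) (some ⟨u, hu⟩) (some ⟨v, hv⟩) := by
  refine ⟨hadj, {o | ∃ x, o = some x ∧ (x : V) ∈ X}, {o | ∃ y, o = some y ∧ (y : V) ∈ Y},
    none, some ⟨q, hq⟩, ⟨_, rfl, huX⟩, ⟨_, rfl, hvY⟩, ?_, by simp, by simp, ?_, ?_, ?_, ?_, ?_, ?_⟩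
  · rintro _ ⟨x, rfl, hx⟩ ⟨y, hy, hyY⟩
    rw [Option.some_inj] at hy
    subst hy
    exact hXY x hx hyY
  · rintro ⟨y, hy, hyY⟩
    rw [Option.some_inj] at hy
    subst hy
    exact hqX hyY
  · rintro ⟨y, hy, hyY⟩
    rw [Option.some_inj] at hy
    subst hy
    exact hqY hyY
  · rintro (_ | ⟨z, hz⟩)
    · simp
    · have hzp : z ≠ p := fun h => hz (h ▸ hp)
      simpa [hzp, hz] using hcov z
  · rintro _ ⟨⟨x, hxQ⟩, rfl, hx⟩ _ ⟨⟨y, hyQ⟩, rfl, hy⟩ hxy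
    simpa using he x hx y hy hxy
  · obtain ⟨x, hx, hxQ, hxu⟩ := hX
    exact ⟨some ⟨x, hxQ⟩, ⟨_, rfl, hx⟩, by simpa⟩
  · obtain ⟨x, hx, hxQ, hxu⟩ := hY
    exact ⟨some ⟨x, hxQ⟩, ⟨_, rfl, hx⟩, by simpa⟩

/-- An edge with both ends in `F`, or with one end in `F` and another end outside `F` all of whose
neighbors are in `F`. -/
def RelevantEdge {V : Type*} (G : SimpleGraph V) (F : Set V) (u v : V) : Prop :=
  (u ∈ F ∧ v ∈ F) ∨ (v ∈ F ∧ u ∉ F ∧ ∀ y, G.Adj u y → y ∈ F) ∨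
    (u ∈ F ∧ v ∉ F ∧ ∀ y, G.Adj v y → y ∈ F)

theorem RelevantEdge.symm {V : Type*} {G : SimpleGraph V} {F : Set V} {u v : V}
    (h : RelevantEdge G F u v) : RelevantEdge G F v u := by
  unfold RelevantEdge at *
  tauto

theorem SplitEdge.false_of_neighbors {V : Type*} {G : SimpleGraph V} (hG : NoSmallCut G)
    {v q u r : V} (h : SplitEdge G v q) (hvu : G.Adj v u) (hvr : G.Adj v r) (hqu : G.Adj q u)
    (hqr : G.Adj q r) (hur : u ≠ r) (hv : ∀ y, G.Adj v y → y = u ∨ y = q ∨ y = r) : False := by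
  obtain ⟨hadj, X, Y, a, b, hvX, hqY, hXY, haX, haY, hbX, hbY, hcov, he, ⟨x, hx, hxv⟩, -⟩ := h
  have common : ∀ t, G.Adj v t → G.Adj q t → t = a ∨ t = b := fun t h1 h2 => by
    rcases hcov t with h | h | h
    · exact absurd (he t h q hqY h2.symm).1 h1.ne'
    · exact absurd (he v hvX t h h1).2 h2.ne'
    · exact h
  have h1 := common u hvu hqu
  have h2 := common r hvr hqr
  have h3 : ∀ t, t = a ∨ t = b → t = u ∨ t = r := by grind
  have h4 : u ∉ X ∧ r ∉ X := by grind
  rcases hG (X \ {v}) u r ⟨x, hx, hxv⟩ (by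
    rintro y ⟨hy, hyv⟩ z hyz
    rcases hcov z with h | h | h
    · refine Or.inl ⟨h, ?_⟩
      rintro rfl
      rcases hv y hyz.symm with rfl | rfl | rfl
      · exact h4.1 hy
      · exact hXY _ hy hqY
      · exact h4.2 hy
    · exact absurd (he y hy z h hyz).1 hyv
    · exact Or.inr (h3 z h)) v with h5 | h5 | h5
  · exact h5.2 rfl
  · exact hvu.ne h5
  · exact hvr.ne h5

/-- The case in which the side of `u` loses all vertices but `u` when `Q` is contracted. -/
theorem MixedCut.splitEdge_contract_of_singleton {V : Type*} [Finite V] {G : SimpleGraph V}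
    {P Q : Set V} (h : MixedCut G P Q) (hG : NoSmallCut G) (hcard : 3 < Nat.card V) {F : Set V}
    (hdeg : ∀ v, v ∉ F → (G.neighborSet v).ncard = 3)
    (hff : ∀ u ∈ F, ∀ v ∈ F, G.Adj u v → SplitEdge G u v) {X Y : Set V} {u v p q : V}
    (hu : u ∉ Q) (hv : v ∉ Q) (hrel : RelevantEdge G F u v) (hsplit : SplitEdge G u v)
    (huX : u ∈ X) (hvY : v ∈ Y)
    (hXY : ∀ x ∈ X, x ∉ Y) (hp : p ∈ Q) (hq : q ∉ Q) (hqX : q ∉ X) (hqY : q ∉ Y)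
    (hcov : ∀ z, z ∈ X ∨ z ∈ Y ∨ z = p ∨ z = q)
    (he : ∀ x ∈ X, ∀ y ∈ Y, G.Adj x y → x = u ∧ y = v) (hX : ∃ x ∈ X, x ≠ u)
    (hXQ : ∀ x ∈ X, x ∉ Q → x = u) :
    SplitEdge (contract G Q) (some ⟨u, hu⟩) (some ⟨v, hv⟩) := by
  have hadj := hsplit.1
  have huY := hXY u huX
  have huq : u ≠ q := fun h => hqX (h ▸ huX)
  have hvq : v ≠ q := fun h => hqY (h ▸ hvY)
  have hNu : ∀ y, G.Adj u y → y ∉ Q → y = v ∨ y = q := fun y huy hy => by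
    rcases hcov y with h1 | h1 | rfl | h1
    · exact absurd (hXQ y h1 hy) huy.ne'
    · exact Or.inl (he u huX y h1 huy).2
    · exact absurd hp hy
    · exact Or.inr h1
  have huq_adj : G.Adj u q := by
    obtain ⟨z, hzQ, hz, hzv⟩ := h.exists_adj_notMem hG hcard hu v
    rcases hNu z hz hzQ with h1 | rfl
    · exact absurd h1 hzv
    · exact hz
  obtain ⟨x, hx, hxu⟩ := hX
  have hxQ : x ∈ Q := by_contra fun hxQ => hxu (hXQ x hx hxQ)
  have hDcl : ∀ y ∈ X ∩ Q, ∀ z, G.Adj y z → z ∈ X ∩ Q ∨ z = u ∨ z = p ∨ z = q := by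
    rintro y ⟨hyX, hyQ⟩ z hyz
    rcases hcov z with h1 | h1 | h1 | h1
    · by_cases hz : z ∈ Q
      · exact Or.inl ⟨h1, hz⟩
      · exact Or.inr (Or.inl (hXQ z h1 hz))
    · exact absurd ((he y hyX z h1 hyz).1 ▸ hyQ) hu
    · exact Or.inr (Or.inr (Or.inl h1))
    · exact Or.inr (Or.inr (Or.inr h1))
  have hvp : v ≠ p := fun h => hv (h ▸ hp)
  have hub : u ∉ Q ∧ ∃ y ∈ Q, G.Adj u y := by
    refine ⟨hu, by_contra fun hcon => ?_⟩
    have := hG (X ∩ Q) p q ⟨x, hx, hxQ⟩ (fun y hy z hyz => by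
      rcases hDcl y hy z hyz with h1 | rfl | h1
      · exact Or.inl h1
      · exact absurd ⟨y, hy.2, hyz.symm⟩ hcon
      · exact Or.inr h1) v
    rcases this with h1 | h1 | h1
    · exact hv h1.2
    · exact hvp h1
    · exact hvq h1
  have hqb : q ∉ Q ∧ ∃ y ∈ Q, G.Adj q y := by
    refine ⟨hq, by_contra fun hcon => ?_⟩
    have := hG (X ∩ Q) p u ⟨x, hx, hxQ⟩ (fun y hy z hyz => by
      rcases hDcl y hy z hyz with h1 | h1 | h1 | rfl
      · exact Or.inl h1
      · exact Or.inr (Or.inr h1)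
      · exact Or.inr (Or.inl h1)
      · exact absurd ⟨y, hy.2, hyz.symm⟩ hcon) v
    rcases this with h1 | h1 | h1
    · exact hv h1.2
    · exact hvp h1
    · exact hadj.ne h1.symm
  obtain ⟨r, hru, hrq, hr⟩ := exists_third h.boundary_left hub hqb huq
  obtain ⟨hrQ, yr, hyrQ, hryr⟩ := (hr r).mpr (Or.inr (Or.inr rfl))
  obtain ⟨yq, hyqQ, hqyq⟩ := hqb.2
  obtain ⟨yu, hyuQ, huyu⟩ := hub.2
  have hneQ : ∀ {a b : V}, a ∉ Q → b ∈ Q → a ≠ b := fun ha hb hab => ha (hab ▸ hb)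
  by_cases hvr : v = r
  · subst hvr
    have hcov3 : ∀ z, z ∉ Q → z = u ∨ z = q ∨ z = v := by
      by_contra! hcon
      obtain ⟨z, hzQ, hzu, hzq, hzv⟩ := hcon
      have := hG {z | z ∉ Q ∧ z ≠ u ∧ z ≠ q ∧ z ≠ v} q v ⟨z, hzQ, hzu, hzq, hzv⟩ (by
        rintro a ⟨haQ, hau, haq, hav⟩ b hab
        by_cases hbQ : b ∈ Q
        · have := (hr a).mp ⟨haQ, b, hbQ, hab⟩
          tauto
        · by_cases hbu : b = u
          · subst hbu
            have := hNu a hab.symm haQ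
            tauto
          · by_cases hbq : b = q
            · exact Or.inr (Or.inl hbq)
            · by_cases hbv : b = v
              · exact Or.inr (Or.inr hbv)
              · exact Or.inl ⟨hbQ, hbu, hbq, hbv⟩) u
      rcases this with h1 | h1 | h1
      · exact h1.2.1 rfl
      · exact huq h1
      · exact hru h1.symm
    have hvq_adj : G.Adj v q := by
      obtain ⟨z, hzQ, hz, hzu⟩ := h.exists_adj_notMem hG hcard hv u
      rcases hcov3 z hzQ with rfl | rfl | rfl
      · exact absurd rfl hzu
      · exact hz
      · exact absurd rfl hz.ne
    exfalso
    have deg : ∀ t, t ∈ P → ∀ a b y, G.Adj t a → G.Adj t b → a ≠ b → y ∈ Q → G.Adj t y →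
        a ∉ Q → b ∉ Q → (∀ z, z ∉ Q → z = t ∨ z = a ∨ z = b) →
        (G.neighborSet t).ncard = 3 := by
      intro t ht a b y hta htb hab hy hty ha hb hcov
      rw [ncard_neighborSet_eq_three_iff]
      refine ⟨a, b, y, hab, hneQ ha hy, hneQ hb hy, fun z => ⟨fun hz => ?_, ?_⟩⟩
      · by_cases hzQ : z ∈ Q
        · exact Or.inr (Or.inr (h.unique_left t ht z hzQ y hy hz hty))
        · rcases hcov z hzQ with h1 | h1 | h1
          · exact absurd h1 hz.ne'
          · exact Or.inl h1
          · exact Or.inr (Or.inl h1)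
      · rintro (rfl | rfl | rfl) <;> assumption
    by_cases hqP : q ∈ P
    · exact hG.not_splitEdge_of_triangle hsplit huq_adj.symm hvq_adj.symm
        (deg q hqP u v yq huq_adj.symm hvq_adj.symm hadj.ne hyqQ hqyq hu hv
          (fun z hz => by have := hcov3 z hz; tauto))
    · have hP2 : u ∈ P ∧ v ∈ P := by
        obtain ⟨a, ha, b, hb, hab⟩ := h.nontrivial_left
        have h1 := hcov3 a (h.disjoint a ha)
        have h2 := hcov3 b (h.disjoint b hb)
        grind
      have hqF : q ∈ F := h.mem_of_degree hdeg hqP hq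
      have hud := deg u hP2.1 v q yu hadj huq_adj hvq hyuQ huyu hv hq
        (fun z hz => by have := hcov3 z hz; tauto)
      have hvd := deg v hP2.2 u q yr hadj.symm hvq_adj huq hyrQ hryr hu hq
        (fun z hz => by have := hcov3 z hz; tauto)
      by_cases huF : u ∈ F
      · exact hG.not_splitEdge_of_triangle (hff u huF q hqF huq_adj) hadj.symm hvq_adj hvd
      · have hvF : v ∈ F := by unfold RelevantEdge at hrel; tauto
        exact hG.not_splitEdge_of_triangle (hff v hvF q hqF hvq_adj) hadj huq_adj hud
  · have hvb : ∀ y ∈ Q, ¬ G.Adj v y := fun y hy hvy => by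
      have h1 := (hr v).mp ⟨hv, y, hy, hvy⟩
      have h2 := hadj.ne
      grind
    by_cases hY : ∃ y, y ∉ Q ∧ y ≠ u ∧ y ≠ q ∧ y ≠ r ∧ y ≠ v
    · obtain ⟨y, hyQ, hyu, hyq, hyr, hyv⟩ := hY
      refine splitEdge_contract_of_subset hu hv hadj (X := insert u Q)
        (Y := {y | y ∉ Q ∧ y ≠ u ∧ y ≠ q ∧ y ≠ r}) (p := q) (q := r) (Or.inl rfl)
        ⟨hv, hadj.ne', hvq, hvr⟩ ?_ hq hrQ ?_ (fun h => h.2.2.1 rfl) ?_ (fun h => h.2.2.2 rfl)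
        ?_ ?_ (fun x hx => Or.inr hx) ⟨y, ⟨hyQ, hyu, hyq, hyr⟩, hyv⟩
      · rintro x (rfl | hxQ) ⟨h1, h2, -⟩
        · exact h2 rfl
        · exact h1 hxQ
      · rintro (h1 | h1)
        · exact huq h1.symm
        · exact hq h1
      · rintro (h1 | h1)
        · exact hru h1
        · exact hrQ h1
      · intro z
        simp only [Set.mem_insert_iff, Set.mem_ofPred_eq]
        tauto
      · rintro x (rfl | hxQ) y ⟨h1, h2, h3, h4⟩ hxy
        · rcases hNu y hxy h1 with rfl | h5
          · exact ⟨rfl, rfl⟩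
          · exact absurd h5 h3
        · have := (hr y).mp ⟨h1, x, hxQ, hxy.symm⟩
          tauto
    · exfalso
      push Not at hY
      have hcov4 : ∀ z, z ∉ Q → z = u ∨ z = q ∨ z = r ∨ z = v := fun z hz => by
        have := hY z hz
        tauto
      have hNv : ∀ y, G.Adj v y → y = u ∨ y = q ∨ y = r := fun y hvy => by
        have hyQ : y ∉ Q := fun hyQ => hvb y hyQ hvy
        rcases hcov4 y hyQ with h1 | h1 | h1 | h1
        · exact Or.inl h1
        · exact Or.inr (Or.inl h1)
        · exact Or.inr (Or.inr h1)
        · exact absurd h1 hvy.ne'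
      have hvq_adj : G.Adj v q := by
        obtain ⟨z, hz, hzu, hzr⟩ := hG.exists_adj_ne hcard v u r
        rcases hNv z hz with h1 | rfl | h1
        · exact absurd h1 hzu
        · exact hz
        · exact absurd h1 hzr
      have hvr_adj : G.Adj v r := by
        obtain ⟨z, hz, hzu, hzr⟩ := hG.exists_adj_ne hcard v u q
        rcases hNv z hz with h1 | h1 | rfl
        · exact absurd h1 hzu
        · exact absurd h1 hzr
        · exact hz
      have hrq_adj : G.Adj r q := by
        obtain ⟨z, hzQ, hz, hzv⟩ := h.exists_adj_notMem hG hcard hrQ v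
        rcases hcov4 z hzQ with rfl | rfl | rfl | rfl
        · rcases hNu r hz.symm hrQ with h1 | h1
          · exact absurd h1.symm hvr
          · exact absurd h1 hrq
        · exact hz
        · exact absurd rfl hz.ne
        · exact absurd rfl hzv
      have hqF : q ∈ F := by
        by_contra hqF
        have := _root_.four_le_ncard_neighborSet huq_adj.symm hvq_adj.symm hrq_adj.symm hqyq hadj.ne
          hru.symm (hneQ hu hyqQ) hvr (hneQ hv hyqQ) (hneQ hrQ hyqQ)
        have := hdeg q hqF
        omega
      by_cases hvF : v ∈ F
      · exact (hff v hvF q hqF hvq_adj).false_of_neighbors hG hadj.symm hvr_adj huq_adj.symm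
          hrq_adj.symm hru.symm hNv
      · have huF : u ∈ F := by unfold RelevantEdge at hrel; tauto
        exact hG.not_splitEdge_of_triangle (hff u huF q hqF huq_adj) hadj.symm hvq_adj
          (hdeg v hvF)

theorem MixedCut.splitEdge_contract_of_mem {V : Type*} [Finite V] {G : SimpleGraph V}
    {P Q : Set V} (h : MixedCut G P Q) (hG : NoSmallCut G) (hcard : 3 < Nat.card V) {F : Set V}
    (hdeg : ∀ v, v ∉ F → (G.neighborSet v).ncard = 3)
    (hff : ∀ u ∈ F, ∀ v ∈ F, G.Adj u v → SplitEdge G u v) {X Y : Set V} {u v p q : V}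
    (hu : u ∉ Q) (hv : v ∉ Q) (hrel : RelevantEdge G F u v) (hsplit : SplitEdge G u v)
    (huX : u ∈ X) (hvY : v ∈ Y)
    (hXY : ∀ x ∈ X, x ∉ Y) (hp : p ∈ Q) (hq : q ∉ Q) (hqX : q ∉ X) (hqY : q ∉ Y)
    (hcov : ∀ z, z ∈ X ∨ z ∈ Y ∨ z = p ∨ z = q)
    (he : ∀ x ∈ X, ∀ y ∈ Y, G.Adj x y → x = u ∧ y = v) (hX : ∃ x ∈ X, x ≠ u)
    (hY : ∃ y ∈ Y, y ≠ v) :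
    SplitEdge (contract G Q) (some ⟨u, hu⟩) (some ⟨v, hv⟩) := by
  by_cases hX' : ∃ x ∈ X, x ∉ Q ∧ x ≠ u
  · by_cases hY' : ∃ y ∈ Y, y ∉ Q ∧ y ≠ v
    · exact _root_.splitEdge_contract_of_mem hu hv hsplit.1 huX hvY hXY hp hq hqX hqY hcov he hX' hY'
    · push Not at hY'
      exact (h.splitEdge_contract_of_singleton hG hcard hdeg hff hv hu hrel.symm hsplit.symm hvY huX
        (fun x hx hx' => hXY x hx' hx) hp hq hqY hqX
        (fun z => by have := hcov z; tauto)
        (fun x hx y hy hxy => (he y hy x hx hxy.symm).symm) hY hY').symm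
  · push Not at hX'
    exact h.splitEdge_contract_of_singleton hG hcard hdeg hff hu hv hrel hsplit huX hvY hXY hp hq
      hqX hqY hcov he hX hX'

theorem MixedCut.splitEdge_contract {V : Type*} [Finite V] {G : SimpleGraph V}
    {P Q : Set V} (h : MixedCut G P Q) (hG : NoSmallCut G) (hcard : 3 < Nat.card V) {F : Set V}
    (hdeg : ∀ v, v ∉ F → (G.neighborSet v).ncard = 3)
    (hff : ∀ u ∈ F, ∀ v ∈ F, G.Adj u v → SplitEdge G u v) {u v : V}
    (hu : u ∉ Q) (hv : v ∉ Q) (hrel : RelevantEdge G F u v) (hsplit : SplitEdge G u v) :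
    SplitEdge (contract G Q) (some ⟨u, hu⟩) (some ⟨v, hv⟩) := by
  obtain ⟨hadj, X, Y, p, q, huX, hvY, hXY, hpX, hpY, hqX, hqY, hcov, he, hX, hY⟩ := id hsplit
  have hcov' : ∀ z, z ∈ X ∨ z ∈ Y ∨ z = q ∨ z = p := fun z => by have := hcov z; tauto
  by_cases hp : p ∈ Q <;> by_cases hq : q ∈ Q
  · exfalso
    have side : ∀ (X Y : Set V) (u v : V), u ∈ X → v ∈ Y → (∀ x ∈ X, x ∉ Y) → u ∉ Q → v ∉ Q →
        G.Adj u v → (∀ x ∈ X, ∀ y ∈ Y, G.Adj x y → x = u ∧ y = v) →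
        (∀ z, z ∉ Q → z ∈ X ∨ z ∈ Y) → ∀ x ∈ X, x ∉ Q → x = u := by
      intro X Y u v huX hvY hXY hu hv hadj he hcov x hx hxQ
      by_contra hxu
      have := h.eq_univ_of_closed hG hcard (A := {x | x ∈ X ∧ x ∉ Q ∧ x ≠ u}) (q := u)
        ⟨x, hx, hxQ, hxu⟩ (fun x hx => hx.2.1) hu (by
        rintro a ⟨haX, haQ, hau⟩ b hab
        by_cases hbQ : b ∈ Q
        · exact Or.inr (Or.inl hbQ)
        · by_cases hbu : b = u
          · exact Or.inr (Or.inr hbu)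
          · rcases hcov b hbQ with h1 | h1
            · exact Or.inl ⟨h1, hbQ, hbu⟩
            · exact absurd (he a haX b h1 hab).1 hau) v
      rcases this with h1 | h1 | h1
      · exact hXY v h1.1 hvY
      · exact hv h1
      · exact hadj.ne h1.symm
    have hcov2 : ∀ z, z ∉ Q → z ∈ X ∨ z ∈ Y := fun z hz => by
      rcases hcov z with h1 | h1 | rfl | rfl
      · exact Or.inl h1
      · exact Or.inr h1
      · exact absurd hp hz
      · exact absurd hq hz
    have h1 := side X Y u v huX hvY hXY hu hv hadj he hcov2
    have h2 := side Y X v u hvY huX (fun x hx hx' => hXY x hx' hx) hv hu hadj.symm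
      (fun x hx y hy hxy => (he y hy x hx hxy.symm).symm) fun z hz => (hcov2 z hz).symm
    have h3 : ∀ z, z ∉ Q → z = u ∨ z = v := fun z hz => (hcov2 z hz).imp
      (fun h => h1 z h hz) fun h => h2 z h hz
    obtain ⟨a, b, c, hab, hac, hbc, hN⟩ := h.boundary_left
    have ha := h3 a ((hN a).mpr (Or.inl rfl)).1
    have hb := h3 b ((hN b).mpr (Or.inr (Or.inl rfl))).1
    have hc := h3 c ((hN c).mpr (Or.inr (Or.inr rfl))).1
    grind
  · exact h.splitEdge_contract_of_mem hG hcard hdeg hff hu hv hrel hsplit huX hvY hXY hp hq hqX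
      hqY hcov he hX hY
  · exact h.splitEdge_contract_of_mem hG hcard hdeg hff hu hv hrel hsplit huX hvY hXY hq hp hpX
      hpY hcov' he hX hY
  · have hQ : ∀ z ∈ Q, z ∈ X ∨ z ∈ Y := fun z hz => by
      rcases hcov z with h1 | h1 | rfl | rfl
      · exact Or.inl h1
      · exact Or.inr h1
      · exact absurd hz hp
      · exact absurd hz hq
    by_cases hQX : ∃ z, z ∈ X ∧ z ∈ Q
    · have := h.eq_right_of_closed hG (Z := X ∩ Q) (fun z hz => hz.2) hQX (by
        rintro x ⟨hxX, hxQ⟩ y hyQ hxy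
        rcases hQ y hyQ with h1 | h1
        · exact ⟨h1, hyQ⟩
        · exact absurd ((he x hxX y h1 hxy).1 ▸ hxQ) hu)
      exact splitEdge_contract_of_subset hu hv hadj huX hvY hXY hp hq hpX hpY hqX hqY hcov he
        (fun x hx => (this x hx).1) hY
    · refine (splitEdge_contract_of_subset hv hu hadj.symm hvY huX (fun x hx hx' => hXY x hx' hx)
        hp hq hpY hpX hqY hqX (fun z => by have := hcov z; tauto)
        (fun x hx y hy hxy => (he y hy x hx hxy.symm).symm) (fun x hx => ?_) hX).symm
      rcases hQ x hx with h1 | h1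
      · exact absurd ⟨x, h1, hx⟩ hQX
      · exact h1

/-- The graphs arising in the induction: `F` contains all vertices of degree at least four and
the separator vertices of earlier contractions, `W` consists of contracted vertices. -/
structure Admissible {V : Type*} (G : SimpleGraph V) (F W : Set V) : Prop where
  noSmallCut : NoSmallCut G
  card : 3 < Nat.card V
  degree : ∀ v, v ∉ F → (G.neighborSet v).ncard = 3
  notMem : ∀ v ∈ W, v ∉ F
  splitEdge : ∀ u ∈ F, ∀ v ∈ F, G.Adj u v → SplitEdge G u v
  exists_splitEdge : ∀ v, v ∉ F → v ∉ W → (∀ x, G.Adj v x → x ∈ F) → ∃ x, SplitEdge G v x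

theorem Admissible.contract {V : Type*} [Finite V] {G : SimpleGraph V} {F W P Q : Set V}
    (h : Admissible G F W) (hc : MixedCut G P Q) :
    Admissible (contract G Q) {o | ∃ x, o = some x ∧ (x : V) ∈ F}
      {o | ∀ x, o = some x → (x : V) ∈ W} where
  noSmallCut := hc.noSmallCut_contract h.noSmallCut h.card
  card := hc.card_contract.1
  degree := by
    rintro (_ | ⟨v, hv⟩) hF
    · exact hc.ncard_neighborSet_contract_none
    · have hvF : v ∉ F := fun h' => hF ⟨_, rfl, h'⟩
      have hvP : v ∈ P := by_contra fun hP => hvF (hc.mem_of_degree h.degree hP hv)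
      rw [hc.ncard_neighborSet_contract_some hvP hv]
      exact h.degree v hvF
  notMem := by
    rintro _ hW ⟨x, rfl, hx⟩
    exact h.notMem x (hW x rfl) hx
  splitEdge := by
    rintro _ ⟨⟨u, hu⟩, rfl, huF⟩ _ ⟨⟨v, hv⟩, rfl, hvF⟩ hadj
    exact hc.splitEdge_contract h.noSmallCut h.card h.degree h.splitEdge hu hv
      (Or.inl ⟨huF, hvF⟩) (h.splitEdge u huF v hvF hadj)
  exists_splitEdge := by
    rintro (_ | ⟨v, hv⟩) hF hW hN
    · exact absurd (fun x hx => by simp at hx) hW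
    · have hvF : v ∉ F := fun h' => hF ⟨_, rfl, h'⟩
      have hvW : v ∉ W := fun h' => hW fun x hx => by
        rw [Option.some_inj] at hx
        exact hx ▸ h'
      have hN' : ∀ y, G.Adj v y → y ∉ Q ∧ y ∈ F := by
        intro y hvy
        have hyQ : y ∉ Q := fun hyQ => by
          obtain ⟨x, hx, -⟩ := hN none ⟨y, hyQ, hvy⟩
          simp at hx
        obtain ⟨x, hx, hxF⟩ := hN (some ⟨y, hyQ⟩) hvy
        rw [Option.some_inj] at hx
        exact ⟨hyQ, by rwa [← hx] at hxF⟩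
      obtain ⟨x, hx⟩ := h.exists_splitEdge v hvF hvW fun y hy => (hN' y hy).2
      exact ⟨_, hc.splitEdge_contract h.noSmallCut h.card h.degree h.splitEdge hv (hN' x hx.1).1
        (Or.inr (Or.inl ⟨(hN' x hx.1).2, hvF, fun y hy => (hN' y hy).2⟩)) hx⟩

open Classical in
/-- The weight of a vertex in the counting argument. -/
noncomputable def weight {V : Type*} (G : SimpleGraph V) (F W : Set V) (v : V) : ℤ :=
  if v ∈ F then if (G.neighborSet v).ncard = 3 then -1 else -2 else if v ∈ W then 3 else 2

theorem sum_subtype_eq {V : Type*} [Fintype V] (p : V → Prop) [DecidablePred p]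
    [Fintype {x // p x}] (f : V → ℤ) :
    ∑ x : {x // p x}, f x = ∑ x, if p x then f x else 0 := by
  rw [← Finset.sum_filter, Finset.sum_subtype _ (p := p) (by simp)]

open Classical in
theorem ncard_neighborSet_eq_sum {V : Type*} [Fintype V] (G : SimpleGraph V) (v : V) :
    ((G.neighborSet v).ncard : ℤ) = ∑ u, if G.Adj v u then 1 else 0 := by
  rw [Finset.sum_boole, Set.ncard_eq_toFinset_card', ← neighborFinset_def,
    neighborFinset_eq_filter]

open Classical in
theorem sum_degree_eq_sum {V : Type*} [Fintype V] {G : SimpleGraph V} {F : Set V}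
    (hF : ∀ u ∈ F, ∀ v ∈ F, ¬ G.Adj u v) :
    (∑ v, if v ∈ F then ((G.neighborSet v).ncard : ℤ) else 0) =
      ∑ v, if v ∈ F then 0 else ∑ u, if G.Adj v u ∧ u ∈ F then 1 else 0 := by
  have h1 : ∀ v, (if v ∈ F then ((G.neighborSet v).ncard : ℤ) else 0) =
      ∑ u, if G.Adj u v ∧ v ∈ F then 1 else 0 := by
    intro v
    split_ifs with hv
    · rw [ncard_neighborSet_eq_sum]
      simp [hv, G.adj_comm]
    · simp [hv]
  simp_rw [h1]
  rw [Finset.sum_comm]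
  refine Finset.sum_congr rfl fun v _ => ?_
  split_ifs with hv
  · refine Finset.sum_eq_zero fun u _ => if_neg fun h => hF v hv u h.2 h.1
  · rfl

open Classical in
theorem sum_neighbors_le {V : Type*} [Fintype V] {G : SimpleGraph V} {F W : Set V}
    (hdeg : ∀ v, v ∉ F → (G.neighborSet v).ncard = 3)
    (hW : ∀ v, v ∉ F → v ∉ W → ∃ x, G.Adj v x ∧ x ∉ F) {v : V} (hv : v ∉ F) :
    (∑ u, if G.Adj v u ∧ u ∈ F then 1 else 0) ≤ weight G F W v := by
  have h1 : (∑ u, if G.Adj v u then (1 : ℤ) else 0) = 3 := by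
    rw [← ncard_neighborSet_eq_sum, hdeg v hv]; rfl
  have h2 : ∀ u, (if G.Adj v u ∧ u ∈ F then (1 : ℤ) else 0) ≤ if G.Adj v u then 1 else 0 := by
    intro u
    split_ifs <;> simp_all
  by_cases hvW : v ∈ W
  · simp only [weight, hv, hvW, if_true, if_false]
    rw [← h1]
    exact Finset.sum_le_sum fun u _ => h2 u
  · simp only [weight, hv, hvW, if_false]
    obtain ⟨x, hvx, hx⟩ := hW v hv hvW
    have := Finset.sum_lt_sum (fun u _ => h2 u) ⟨x, Finset.mem_univ x, by simp [hvx, hx]⟩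
    omega

open Classical in
theorem sum_degree_le_of_connected {V : Type*} [Fintype V] {G : SimpleGraph V} {F : Set V}
    (hF : ∀ u ∈ F, ∀ v ∈ F, ¬ G.Adj u v) (hdeg : ∀ v, v ∉ F → (G.neighborSet v).ncard = 3)
    (hconn : (G.induce Fᶜ).Connected) :
    (∑ v, if v ∈ F then ((G.neighborSet v).ncard : ℤ) else 0) ≤
      (∑ v, if v ∈ F then 0 else 1) + 2 := by
  have h1 := hconn.card_vert_le_card_edgeSet_add_one
  have h2 := sum_degrees_eq_twice_card_edges (G.induce Fᶜ)
  have hT : (Nat.card (Fᶜ : Set V) : ℤ) = ∑ v, if v ∈ F then 0 else 1 := by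
    have := sum_subtype_eq (fun v => v ∈ Fᶜ) fun _ => 1
    rw [Nat.card_eq_fintype_card, ← Finset.card_univ, Finset.cast_card]
    rw [this]
    exact Finset.sum_congr rfl fun v _ => by simp [ite_not]
  have hE : (2 * Nat.card (G.induce Fᶜ).edgeSet : ℤ) =
      ∑ v, if v ∈ F then 0 else ∑ u, if G.Adj v u ∧ u ∉ F then 1 else 0 := by
    rw [Nat.card_eq_fintype_card, ← edgeFinset_card]
    have h3 : ((∑ v, (G.induce Fᶜ).degree v : ℕ) : ℤ) =
        ∑ v : {v // v ∈ Fᶜ}, ∑ u, if G.Adj v u ∧ u ∉ F then 1 else 0 := by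
      rw [Nat.cast_sum]
      refine Finset.sum_congr rfl fun v _ => ?_
      have h4 := ncard_neighborSet_eq_sum (G.induce Fᶜ) v
      rw [Set.ncard_eq_toFinset_card', ← neighborFinset_def, card_neighborFinset_eq_degree] at h4
      rw [h4]
      have h5 := sum_subtype_eq (fun v => v ∈ Fᶜ) fun u => if G.Adj v u then 1 else 0
      refine Eq.trans ?_ (h5.trans ?_)
      · rfl
      · refine Finset.sum_congr rfl fun u _ => ?_
        by_cases hu : u ∈ F <;> simp [hu]
    rw [h2] at h3
    have h6 := sum_subtype_eq (fun v => v ∈ Fᶜ)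
      fun v => ∑ u, if G.Adj v u ∧ u ∉ F then 1 else 0
    push_cast at h3
    rw [h3, h6]
    exact Finset.sum_congr rfl fun v _ => by simp [ite_not]
  have hsum : (∑ v, if v ∈ F then (0 : ℤ) else 3) =
      (∑ v, if v ∈ F then 0 else ∑ u, if G.Adj v u ∧ u ∈ F then 1 else 0) +
      ∑ v, if v ∈ F then 0 else ∑ u, if G.Adj v u ∧ u ∉ F then 1 else 0 := by
    rw [← Finset.sum_add_distrib]
    refine Finset.sum_congr rfl fun v _ => ?_
    split_ifs with hv
    · rfl
    · rw [← Finset.sum_add_distrib]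
      have h3 : ((G.neighborSet v).ncard : ℤ) = 3 := by rw [hdeg v hv]; rfl
      rw [← h3, ncard_neighborSet_eq_sum]
      refine Finset.sum_congr rfl fun u _ => ?_
      by_cases hu : u ∈ F <;> simp [hu]
  have h3T : (∑ v, if v ∈ F then (0 : ℤ) else 3) = 3 * ∑ v, if v ∈ F then 0 else 1 := by
    rw [Finset.mul_sum]
    exact Finset.sum_congr rfl fun v _ => by split_ifs <;> simp
  rw [sum_degree_eq_sum hF]
  have h1' : (Nat.card (Fᶜ : Set V) : ℤ) ≤ Nat.card (G.induce Fᶜ).edgeSet + 1 := by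
    exact_mod_cast h1
  linarith

open Classical in
theorem Admissible.six_le_sum_of_no_splitEdge {V : Type*} [Fintype V] {G : SimpleGraph V}
    {F W : Set V} (h : Admissible G F W)
    (hWF : W.Nonempty ∨ ∀ v ∈ F, (G.neighborSet v).ncard ≠ 3)
    (hs : ∀ u v, ¬ SplitEdge G u v) : 6 ≤ ∑ v, weight G F W v := by
  have hF : ∀ u ∈ F, ∀ v ∈ F, ¬ G.Adj u v := fun u hu v hv hadj =>
    hs u v (h.splitEdge u hu v hv hadj)
  have hW : ∀ v, v ∉ F → v ∉ W → ∃ x, G.Adj v x ∧ x ∉ F := by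
    intro v hv hvW
    by_contra! hcon
    obtain ⟨x, hx⟩ := h.exists_splitEdge v hv hvW hcon
    exact hs v x hx
  have hdeg3 := fun v => h.noSmallCut.three_le_ncard_neighborSet h.card v
  have hw2 : ∀ v, v ∉ F → 2 ≤ weight G F W v := fun v hv => by
    simp only [weight, hv, if_false]
    split_ifs <;> norm_num
  have hwF : ∀ v ∈ F, (weight G F W v = -1 ∧ (G.neighborSet v).ncard = 3) ∨
      (weight G F W v = -2 ∧ 4 ≤ (G.neighborSet v).ncard) := fun v hv => by
    simp only [weight, hv, if_true]
    have := hdeg3 v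
    split_ifs <;> simp <;> omega
  set f : ℤ := ∑ v, if v ∈ F then 1 else 0 with hf
  set D : ℤ := ∑ v, if v ∈ F then ((G.neighborSet v).ncard : ℤ) else 0 with hD
  set T : ℤ := ∑ v, if v ∈ F then (0 : ℤ) else 1 with hT
  set w : ℤ := ∑ v, if v ∈ F then weight G F W v else 0 with hw
  have hcard : f + T = Nat.card V := by
    rw [hf, hT, ← Finset.sum_add_distrib, Nat.card_eq_fintype_card, ← Finset.card_univ,
      Finset.cast_card]
    exact Finset.sum_congr rfl fun v _ => by split_ifs <;> simp
  have hfcard : f = F.ncard := by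
    rw [hf, Finset.sum_boole, Set.ncard_eq_toFinset_card']
    congr 2
    ext; simp
  have h4 : (4 : ℤ) ≤ Nat.card V := by exact_mod_cast h.card
  have k1 : D + w ≤ ∑ v, weight G F W v := by
    rw [hD, sum_degree_eq_sum hF, hw, ← Finset.sum_add_distrib]
    refine Finset.sum_le_sum fun v _ => ?_
    split_ifs with hv
    · simp
    · simpa using sum_neighbors_le h.degree hW hv
  have k2 : 2 * f ≤ D + w := by
    rw [hf, hD, hw, ← Finset.sum_add_distrib, Finset.mul_sum]
    refine Finset.sum_le_sum fun v _ => ?_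
    split_ifs with hv
    · rcases hwF v hv with ⟨h1, h2⟩ | ⟨h1, h2⟩ <;> rw [h1] <;> omega
    · simp
  have k3 : 2 * T + w ≤ ∑ v, weight G F W v := by
    rw [hT, hw, Finset.mul_sum, ← Finset.sum_add_distrib]
    refine Finset.sum_le_sum fun v _ => ?_
    split_ifs with hv
    · simp
    · simpa using hw2 v hv
  have k4 : 5 * f ≤ 2 * D + w := by
    rw [hf, hD, hw, Finset.mul_sum, Finset.mul_sum, ← Finset.sum_add_distrib]
    refine Finset.sum_le_sum fun v _ => ?_
    split_ifs with hv
    · rcases hwF v hv with ⟨h1, h2⟩ | ⟨h1, h2⟩ <;> rw [h1] <;> omega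
    · simp
  have hcases : F.ncard = 0 ∨ F.ncard = 1 ∨ F.ncard = 2 ∨ 3 ≤ F.ncard := by omega
  rcases hcases with h0 | h1 | h2 | h3
  · rw [Set.ncard_eq_zero] at h0
    have : w = 0 := by rw [hw]; exact Finset.sum_eq_zero fun v _ => by simp [h0]
    have : f = 0 := by rw [hf]; exact Finset.sum_eq_zero fun v _ => by simp [h0]
    linarith
  · obtain ⟨x, rfl⟩ := Set.ncard_eq_one.mp h1
    have hwx : w = weight G {x} W x := by simp [hw]
    have hx3 := hwF x rfl
    have hlt : (G.neighborSet x).ncard < Nat.card V := by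
      rw [← Set.ncard_univ]
      exact Set.ncard_lt_ncard ⟨Set.subset_univ _, fun hsub => G.irrefl (hsub (Set.mem_univ x))⟩
    rcases hx3 with ⟨hx1, hx2⟩ | ⟨hx1, hx2⟩
    · rcases hWF with ⟨y, hy⟩ | hWF
      · have hyx := h.notMem y hy
        have k5 : 2 * T + w < ∑ v, weight G {x} W v := by
          rw [hT, hw, Finset.mul_sum, ← Finset.sum_add_distrib]
          refine Finset.sum_lt_sum (fun v _ => ?_) ⟨y, Finset.mem_univ y, ?_⟩
          · split_ifs with hv
            · simp
            · simpa using hw2 v hv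
          · simp only [hyx, if_false, weight, hy, if_true]
            norm_num
        rw [h1] at hfcard
        push_cast at hfcard
        linarith
      · exact absurd hx2 (hWF x rfl)
    · rw [h1] at hfcard
      push_cast at hfcard
      have : (5 : ℤ) ≤ Nat.card V := by exact_mod_cast (by omega : 5 ≤ Nat.card V)
      linarith
  · have hne : (Fᶜ : Set V).Nonempty := by
      by_contra hne
      rw [Set.not_nonempty_iff_eq_empty, Set.compl_empty_iff] at hne
      rw [hne, Set.ncard_univ] at h2
      have := h.card
      omega
    have k5 := sum_degree_le_of_connected hF h.degree
      (h.noSmallCut.induce_compl_connected (by omega) hne)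
    rw [h2] at hfcard
    push_cast at hfcard
    linarith
  · have : (3 : ℤ) ≤ F.ncard := by exact_mod_cast h3
    linarith

open Classical in
theorem MixedCut.sum_weight_contract_le {V : Type*} [Fintype V] {G : SimpleGraph V}
    {P Q F W : Set V} (hc : MixedCut G P Q)
    (hdeg : ∀ v, v ∉ F → (G.neighborSet v).ncard = 3) :
    ∑ o, weight (contract G Q) {o | ∃ x, o = some x ∧ (x : V) ∈ F}
      {o | ∀ x, o = some x → (x : V) ∈ W} o ≤
      3 + ∑ v, if v ∉ Q then if v ∈ P then weight G F W v else -1 else 0 := by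
  rw [Fintype.sum_option]
  refine add_le_add (by simp [weight]) ?_
  rw [← sum_subtype_eq (fun v => v ∉ Q) fun v => if v ∈ P then weight G F W v else -1]
  refine Finset.sum_le_sum fun ⟨v, hv⟩ _ => ?_
  simp only
  split_ifs with hP
  · have hW : (∀ a, a ∉ Q → v = a → a ∈ W) ↔ v ∈ W :=
      ⟨fun h => h v hv rfl, by rintro h a - rfl; exact h⟩
    simp [weight, hc.ncard_neighborSet_contract_some hP hv, hv, hW]
  · have := hc.mem_of_degree hdeg hP hv
    simp only [weight, Set.mem_ofPred_eq, Option.some_inj, exists_eq_left', this, if_true]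
    split_ifs <;> norm_num

open Classical in
theorem Admissible.six_le_sum (n : ℕ) : ∀ {V : Type*} [Fintype V] {G : SimpleGraph V}
    {F W : Set V}, Nat.card V = n → Admissible G F W →
    (W.Nonempty ∨ ∀ v ∈ F, (G.neighborSet v).ncard ≠ 3) → 6 ≤ ∑ v, weight G F W v := by
  induction n using Nat.strong_induction_on with
  | _ n ih =>
  intro V _ G F W hn h hWF
  by_cases hs : ∃ u v, SplitEdge G u v
  · obtain ⟨u, v, huv⟩ := hs
    obtain ⟨P, Q, hc⟩ := huv.exists_mixedCut h.noSmallCut h.card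
    have h1 := ih _ (hn ▸ hc.card_contract.2) rfl (h.contract hc) (Or.inl ⟨none, by simp⟩)
    have h2 := ih _ (hn ▸ hc.symm.card_contract.2) rfl (h.contract hc.symm)
      (Or.inl ⟨none, by simp⟩)
    have h3 := hc.sum_weight_contract_le (W := W) h.degree
    have h4 := hc.symm.sum_weight_contract_le (W := W) h.degree
    have h5 : (∑ v, if v ∉ Q then if v ∈ P then weight G F W v else -1 else 0) +
        (∑ v, if v ∉ P then if v ∈ Q then weight G F W v else -1 else 0) ≤
        ∑ v, weight G F W v := by
      rw [← Finset.sum_add_distrib]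
      refine Finset.sum_le_sum fun v _ => ?_
      by_cases hP : v ∈ P
      · simp [hP, hc.disjoint v hP]
      · by_cases hQ : v ∈ Q
        · simp [hP, hQ]
        · have h6 := hc.four_le_ncard_neighborSet hP hQ
          have h7 : (G.neighborSet v).ncard ≠ 3 := by omega
          simp [weight, hP, hQ, h7, hc.mem_of_degree h.degree hP hQ]
    linarith
  · exact h.six_le_sum_of_no_splitEdge hWF fun u v huv => hs ⟨u, v, huv⟩

theorem SuperMinimallyKConnected.exists_separation {V : Type*} [Finite V] {G : SimpleGraph V}
    (h : SuperMinimallyKConnected 3 G) {H : G.Subgraph} (hH : H ≠ ⊤) (hcard : 3 < H.verts.ncard)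
    (hadj : ∀ x ∈ H.verts, ∀ a b, ∃ z, H.Adj x z ∧ z ≠ a ∧ z ≠ b) :
    ∃ (X Y : Set V) (p q : V), X.Nonempty ∧ Y.Nonempty ∧ (∀ x ∈ X, x ∉ Y) ∧
      p ∉ X ∧ p ∉ Y ∧ q ∉ X ∧ q ∉ Y ∧
      (∀ z, z ∈ H.verts ↔ z ∈ X ∨ z ∈ Y ∨ z = p ∨ z = q) ∧ ∀ x ∈ X, ∀ y ∈ Y, ¬ H.Adj x y := by
  have hno : ¬ NoSmallCut H.coe := fun hc => h.2 H hH (hc.kConnected hcard)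
  unfold NoSmallCut at hno
  push Not at hno
  obtain ⟨X, ⟨p, hp⟩, ⟨q, hq⟩, ⟨⟨x, hxH⟩, hx⟩, hcl, ⟨y, hyH⟩, hyX, hyp, hyq⟩ := hno
  have hcl' : ∀ x (hx : x ∈ H.verts), (⟨x, hx⟩ : H.verts) ∈ X → ∀ z (hz : z ∈ H.verts),
      H.Adj x z → (⟨z, hz⟩ : H.verts) ∈ X ∨ z = p ∨ z = q := fun x hx hxX z hz hxz => by
    simpa using hcl ⟨x, hx⟩ hxX ⟨z, hz⟩ hxz
  refine ⟨{z | ∃ hz : z ∈ H.verts, (⟨z, hz⟩ : H.verts) ∈ X ∧ z ≠ p ∧ z ≠ q},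
    {z | ∃ hz : z ∈ H.verts, (⟨z, hz⟩ : H.verts) ∉ X ∧ z ≠ p ∧ z ≠ q}, p, q, ?_,
    ⟨y, hyH, hyX, by simpa using hyp, by simpa using hyq⟩, ?_, ?_, ?_, ?_, ?_, ?_, ?_⟩
  · obtain ⟨z, hxz, hzp, hzq⟩ := hadj x hxH p q
    have hz := H.edge_vert hxz.symm
    exact ⟨z, hz, (hcl' x hxH hx z hz hxz).resolve_right (by tauto), hzp, hzq⟩
  · rintro z ⟨_, h1, _⟩ ⟨_, h2, _⟩
    exact h2 h1
  · rintro ⟨_, _, h1, _⟩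
    exact h1 rfl
  · rintro ⟨_, _, h1, _⟩
    exact h1 rfl
  · rintro ⟨_, _, _, h1⟩
    exact h1 rfl
  · rintro ⟨_, _, _, h1⟩
    exact h1 rfl
  · intro z
    constructor
    · intro hz
      by_cases h1 : (⟨z, hz⟩ : H.verts) ∈ X <;> by_cases h2 : z = p <;> by_cases h3 : z = q <;>
        simp [hz, h1, h2, h3]
    · rintro (⟨h1, -⟩ | ⟨h1, -⟩ | rfl | rfl) <;> assumption
  · rintro a ⟨ha, haX, -⟩ b ⟨hb, hbX, hbp, hbq⟩ hab
    rcases hcl' a ha haX b hb hab with h1 | h1 | h1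
    · exact hbX h1
    · exact hbp h1
    · exact hbq h1

theorem SuperMinimallyKConnected.splitEdge {V : Type*} [Finite V] {G : SimpleGraph V}
    (h : SuperMinimallyKConnected 3 G) {u v : V} (hu : 4 ≤ (G.neighborSet u).ncard)
    (hv : 4 ≤ (G.neighborSet v).ncard) (huv : G.Adj u v) : SplitEdge G u v := by
  have hG := h.1.noSmallCut
  have hadj : ∀ x y, ((⊤ : G.Subgraph).deleteEdges {s(u, v)}).Adj x y ↔
      G.Adj x y ∧ ¬ ((x = u ∧ y = v) ∨ (x = v ∧ y = u)) := fun x y => by simp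
  obtain ⟨X, Y, p, q, hXne, ⟨y, hy⟩, hXY, hpX, hpY, hqX, hqY, hcov, he⟩ :=
    h.exists_separation (H := (⊤ : G.Subgraph).deleteEdges {s(u, v)})
      (fun hc => by
        have h1 := (hadj u v).mp (by rw [hc]; exact huv)
        simp at h1)
      (by simpa [Set.ncard_univ] using h.1.1) (fun x _ a b => by
        simp only [hadj]
        by_cases hxu : x = u
        · obtain ⟨z, hz, h1, h2, h3⟩ := exists_adj_of_four_le_ncard (hxu ▸ hu) a b v
          exact ⟨z, ⟨hz, by rintro (⟨-, h4⟩ | ⟨h4, -⟩); exacts [h3 h4, huv.ne (hxu.symm.trans h4)]⟩,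
            h1, h2⟩
        · by_cases hxv : x = v
          · obtain ⟨z, hz, h1, h2, h3⟩ := exists_adj_of_four_le_ncard (hxv ▸ hv) a b u
            exact ⟨z, ⟨hz, by tauto⟩, h1, h2⟩
          · obtain ⟨z, hz, h1, h2⟩ := hG.exists_adj_ne h.1.1 x a b
            exact ⟨z, ⟨hz, by tauto⟩, h1, h2⟩)
  simp only [hadj, Subgraph.deleteEdges_verts, Subgraph.verts_top, Set.mem_univ, true_iff]
    at hcov he
  have key : ∀ u v : V, 4 ≤ (G.neighborSet u).ncard → 4 ≤ (G.neighborSet v).ncard →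
      G.Adj u v → (∀ x ∈ X, ∀ y ∈ Y, ¬ (G.Adj x y ∧ ¬ ((x = u ∧ y = v) ∨ (x = v ∧ y = u)))) →
      u ∈ X → v ∈ Y → SplitEdge G u v := by
    intro u v hu hv huv he huX hvY
    have he' : ∀ x ∈ X, ∀ y ∈ Y, G.Adj x y → x = u ∧ y = v := fun x hx y hy hxy => by
      by_contra hc
      refine he x hx y hy ⟨hxy, ?_⟩
      rintro (h1 | ⟨rfl, rfl⟩)
      · exact hc h1
      · exact hXY x hx hvY
    refine ⟨huv, X, Y, p, q, huX, hvY, hXY, hpX, hpY, hqX, hqY, hcov, he', ?_, ?_⟩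
    · obtain ⟨z, hz, h1, h2, h3⟩ := exists_adj_of_four_le_ncard hu p q v
      rcases hcov z with h4 | h4 | h4 | h4
      · exact ⟨z, h4, hz.ne'⟩
      · exact absurd (he' u huX z h4 hz).2 h3
      · exact absurd h4 h1
      · exact absurd h4 h2
    · obtain ⟨z, hz, h1, h2, h3⟩ := exists_adj_of_four_le_ncard hv p q u
      rcases hcov z with h4 | h4 | h4 | h4
      · exact absurd (he' z h4 v hvY hz.symm).1 h3
      · exact ⟨z, h4, hz.ne'⟩
      · exact absurd h4 h1
      · exact absurd h4 h2
  by_cases h1 : u ∈ X ∧ v ∈ Y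
  · exact key u v hu hv huv he h1.1 h1.2
  by_cases h2 : v ∈ X ∧ u ∈ Y
  · refine (key v u hv hu huv.symm (fun x hx y hy hc => he x hx y hy ⟨hc.1, ?_⟩) h2.1 h2.2).symm
    tauto
  exfalso
  have h3 := hG X p q hXne (fun x hx z hxz => by
    rcases hcov z with h4 | h4 | h4
    · exact Or.inl h4
    · by_contra
      refine he x hx z h4 ⟨hxz, ?_⟩
      rintro (⟨rfl, rfl⟩ | ⟨rfl, rfl⟩)
      · exact h1 ⟨hx, h4⟩
      · exact h2 ⟨hx, h4⟩
    · exact Or.inr h4) y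
  rcases h3 with h3 | rfl | rfl
  · exact hXY y h3 hy
  · exact hpY hy
  · exact hqY hy

theorem SuperMinimallyKConnected.exists_splitEdge {V : Type*} [Finite V] {G : SimpleGraph V}
    (h : SuperMinimallyKConnected 3 G) {v : V} (hv : (G.neighborSet v).ncard = 3)
    (hnb : ∀ x, G.Adj v x → 4 ≤ (G.neighborSet x).ncard) : ∃ x, SplitEdge G v x := by
  have hG := h.1.noSmallCut
  obtain ⟨a, b, c, -, -, -, habc⟩ := ncard_neighborSet_eq_three_iff.mp hv
  have hadj : ∀ x y, ((⊤ : G.Subgraph).deleteVerts {v}).Adj x y ↔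
      x ≠ v ∧ y ≠ v ∧ G.Adj x y := fun x y => by simp
  have hcard : 3 < ({v}ᶜ : Set V).ncard := by
    have hsub : G.neighborSet a ⊆ {a}ᶜ := fun z hz hza => by
      rw [Set.mem_singleton_iff.mp hza] at hz
      exact G.loopless.irrefl a hz
    have h1 := Set.ncard_le_ncard hsub
    have h2 := hnb a ((habc a).mpr (Or.inl rfl))
    rw [Set.ncard_compl, Set.ncard_singleton] at h1 ⊢
    omega
  obtain ⟨X, Y, p, q, ⟨x, hx⟩, ⟨y, hy⟩, hXY, hpX, hpY, hqX, hqY, hcov, he⟩ :=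
    h.exists_separation (H := (⊤ : G.Subgraph).deleteVerts {v})
      (fun hc => by
        have h1 : v ∈ ((⊤ : G.Subgraph).deleteVerts {v}).verts := by rw [hc]; trivial
        simp at h1)
      (by simpa [Set.compl_eq_univ_sdiff] using hcard) (fun x hx a b => by
        simp only [hadj]
        have hxv : x ≠ v := by simpa using hx
        by_cases hvx : G.Adj v x
        · obtain ⟨z, hz, h1, h2, h3⟩ := exists_adj_of_four_le_ncard (hnb x hvx) a b v
          exact ⟨z, ⟨hxv, h3, hz⟩, h1, h2⟩
        · obtain ⟨z, hz, h1, h2⟩ := hG.exists_adj_ne h.1.1 x a b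
          exact ⟨z, ⟨hxv, fun h3 => hvx (h3 ▸ hz.symm), hz⟩, h1, h2⟩)
  have hcov' : ∀ z, z ≠ v ↔ z ∈ X ∨ z ∈ Y ∨ z = p ∨ z = q := by simpa using hcov
  simp only [hadj] at he
  have hpv : p ≠ v := (hcov' p).mpr (by simp)
  have hqv : q ≠ v := (hcov' q).mpr (by simp)
  have key : ∀ X Y : Set V, X.Nonempty → Y.Nonempty → (∀ x ∈ X, x ∉ Y) →
      p ∉ X → p ∉ Y → q ∉ X → q ∉ Y → (∀ z, z ≠ v ↔ z ∈ X ∨ z ∈ Y ∨ z = p ∨ z = q) →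
      (∀ x ∈ X, ∀ y ∈ Y, ¬ G.Adj x y) →
      (∃ x ∈ X, G.Adj v x) ∧
      ∀ x ∈ X, G.Adj v x → (∀ z ∈ X, G.Adj v z → z = x) → SplitEdge G v x := by
    intro X Y hXne ⟨y, hy⟩ hXY hpX hpY hqX hqY hcov he
    have hvX : v ∉ X := fun hvX => (hcov v).mpr (Or.inl hvX) rfl
    have hvY : v ∉ Y := fun hvY => (hcov v).mpr (Or.inr (Or.inl hvY)) rfl
    constructor
    · by_contra! hno
      have h3 := hG X p q hXne (fun x hx z hxz => by
        have hzv : z ≠ v := by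
          rintro rfl
          exact hno x hx hxz.symm
        rcases (hcov z).mp hzv with h4 | h4 | h4
        · exact Or.inl h4
        · exact absurd hxz (he x hx z h4)
        · exact Or.inr h4) y
      rcases h3 with h3 | rfl | rfl
      · exact hXY y h3 hy
      · exact hpY hy
      · exact hqY hy
    · intro x hx hvx huniq
      refine ⟨hvx, insert v Y, X, p, q, Or.inl rfl, hx, ?_, ?_, hpX, ?_, hqX, ?_, ?_,
        ⟨y, Or.inr hy, fun hyv => hvY (hyv ▸ hy)⟩, ?_⟩
      · rintro z (rfl | hz) hzX
        · exact hvX hzX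
        · exact hXY z hzX hz
      · rintro (h1 | h1)
        · exact hpv h1
        · exact hpY h1
      · rintro (h1 | h1)
        · exact hqv h1
        · exact hqY h1
      · intro z
        by_cases hzv : z = v
        · exact Or.inl (Or.inl hzv)
        · rcases (hcov z).mp hzv with h1 | h1 | h1
          · exact Or.inr (Or.inl h1)
          · exact Or.inl (Or.inr h1)
          · exact Or.inr (Or.inr h1)
      · rintro z (rfl | hz) w hw hzw
        · exact ⟨rfl, huniq w hw hzw⟩
        · exact absurd hzw.symm (he w hw z hz)
      · obtain ⟨z, hz, h1, h2, h3⟩ := exists_adj_of_four_le_ncard (hnb x hvx) p q v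
        rcases (hcov z).mp h3 with h4 | h4 | h4 | h4
        · exact ⟨z, h4, hz.ne'⟩
        · exact absurd hz (he x hx z h4)
        · exact absurd h4 h1
        · exact absurd h4 h2
  have hvXY : ∀ x ∈ X, ∀ y ∈ Y, ¬ G.Adj x y := fun x hx y hy hxy =>
    he x hx y hy ⟨(hcov' x).mpr (Or.inl hx), (hcov' y).mpr (Or.inr (Or.inl hy)), hxy⟩
  have hX := key X Y ⟨x, hx⟩ ⟨y, hy⟩ hXY hpX hpY hqX hqY hcov' hvXY
  have hY := key Y X ⟨y, hy⟩ ⟨x, hx⟩ (fun z hz hz' => hXY z hz' hz) hpY hpX hqY hqX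
    (fun z => by rw [hcov' z]; tauto) fun x hx y hy hxy => hvXY y hy x hx hxy.symm
  obtain ⟨⟨x, hx, hvx⟩, hX⟩ := hX
  obtain ⟨⟨y, hy, hvy⟩, hY⟩ := hY
  by_cases hu : ∀ z ∈ X, G.Adj v z → z = x
  · exact ⟨x, hX x hx hvx hu⟩
  · push Not at hu
    obtain ⟨z, hz, hvz, hzx⟩ := hu
    refine ⟨y, hY y hy hvy fun w hw hvw => ?_⟩
    have hxy : x ≠ y := fun h1 => hXY x hx (h1 ▸ hy)
    have hzy : z ≠ y := fun h1 => hXY z hz (h1 ▸ hy)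
    have hxw : x ≠ w := fun h1 => hXY x hx (h1 ▸ hw)
    have hzw : z ≠ w := fun h1 => hXY z hz (h1 ▸ hw)
    have h1 := (habc x).mp hvx
    have h2 := (habc y).mp hvy
    have h3 := (habc z).mp hvz
    have h4 := (habc w).mp hvw
    grind

theorem SuperMinimallyKConnected.admissible {V : Type*} [Finite V] {G : SimpleGraph V}
    (h : SuperMinimallyKConnected 3 G) :
    Admissible G {v | (G.neighborSet v).ncard ≠ 3} ∅ := by
  have hG := h.1.noSmallCut
  have hfour : ∀ v, (G.neighborSet v).ncard ≠ 3 → 4 ≤ (G.neighborSet v).ncard := fun v hv => by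
    have := hG.three_le_ncard_neighborSet h.1.1 v
    omega
  exact
    { noSmallCut := hG
      card := h.1.1
      degree := fun v hv => not_not.mp hv
      notMem := fun v hv => hv.elim
      splitEdge := fun u hu v hv huv => h.splitEdge (hfour u hu) (hfour v hv) huv
      exists_splitEdge := fun v hv _ hnb =>
        h.exists_splitEdge (not_not.mp hv) fun x hx => hfour x (hnb x hx) }

/-- A super-minimally 3-connected graph `G` has at least `(|V(G)| + 3)/2`
vertices of degree three, i.e. `2·|{v : deg v = 3}| ≥ |V(G)| + 3`. -/
theorem superMinimally_three_connected_degree_three_count {V : Type*} [Fintype V]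
    (G : SimpleGraph V) (h : SuperMinimallyKConnected 3 G) :
    Nat.card V + 3 ≤ 2 * {v : V | (G.neighborSet v).ncard = 3}.ncard := by
  classical
  have h1 := h.admissible.six_le_sum _ rfl (Or.inr fun v hv => hv)
  have h2 : ∀ v, weight G {v | (G.neighborSet v).ncard ≠ 3} ∅ v =
      4 * (if (G.neighborSet v).ncard = 3 then 1 else 0) - 2 := fun v => by
    by_cases hv : (G.neighborSet v).ncard = 3 <;> simp [weight, hv]
  simp only [h2, Finset.sum_sub_distrib, ← Finset.mul_sum, Finset.sum_boole, Finset.sum_const,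
    Finset.card_univ, nsmul_eq_mul] at h1
  rw [Set.ncard_eq_toFinset_card', Set.toFinset_ofPred, Nat.card_eq_fintype_card]
  omega
end
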